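/- arXiv:1706.07641 — 3 statements merged into one kernel-verified Lean document; each statement's English description precedes it below -/
import Mathlib

section
/- Let c be a positive integer and ζ = e^{2πi/c}. For i, j ∈ ℤ/cℤ let Δ_c^{i,j} ∈ ℤ[T] be the minimal polynomial over ℚ of ζ^{i+j} + ζ^{i−j} + ζ^{−i+j} + ζ^{−i−j} + 2, and set Δ_c = lcm of the Δ_c^{i,j}. Then for every field F and every g ∈ Sp₄(F) of order dividing c, Δ_c(χ₂(g)) = 0 in F, where χ₂(g) is the coefficient of T² in the characteristic polynomial of g. -/
open Polynomial

/-- The characteristic polynomial of a symplectic matrix is palindromic. -/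
lemma sp4_charpoly_facts {F : Type*} [Field F] (g : Matrix (Fin 2 ⊕ Fin 2) (Fin 2 ⊕ Fin 2) F)
    (hg : g ∈ Matrix.symplecticGroup (Fin 2) F) :
    g.charpoly.coeff 0 = 1 ∧ g.charpoly.coeff 4 = 1 ∧ g.charpoly.natDegree = 4 ∧
      g.charpoly.coeff 1 = g.charpoly.coeff 3 := by
  have hdet := SymplecticGroup.det_eq_one hg
  have hu : IsUnit g := by
    rw [Matrix.isUnit_iff_isUnit_det, hdet]; exact isUnit_one
  have hdeg : g.charpoly.natDegree = 4 := by
    rw [Matrix.charpoly_natDegree_eq_dim]; simp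
  have h0 : g.charpoly.coeff 0 = 1 := by
    have := Matrix.det_eq_sign_charpoly_coeff g
    rw [hdet] at this
    have h4 : Fintype.card (Fin 2 ⊕ Fin 2) = 4 := by simp
    rw [h4] at this
    linear_combination -this
  have hlead : g.charpoly.coeff 4 = 1 := by
    have := g.charpoly_monic.coeff_natDegree
    rwa [hdeg] at this
  refine ⟨h0, hlead, hdeg, ?_⟩
  have hinv : (g⁻¹).charpoly = g.charpoly := by
    rw [SymplecticGroup.inv_eq_symplectic_inv g hg, Matrix.mul_assoc, Matrix.charpoly_mul_comm,
      Matrix.mul_assoc, mul_neg, Matrix.J_squared, neg_neg, mul_one, Matrix.charpoly_transpose]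
  have hrev : g.charpoly = g.charpoly.reverse := by
    conv_lhs => rw [← hinv, Matrix.charpoly_inv _ hu]
    rw [Matrix.reverse_charpoly]
    simp [hdet]
    ring
  conv_lhs => rw [hrev, coeff_reverse, hdeg]
  rw [revAt_le (by norm_num)]

lemma cyclotomic_root_exists (K : Type*) [Field K] [IsAlgClosed K] (c : ℕ) (hc : 0 < c) :
    ∃ η : K, (cyclotomic c K).IsRoot η ∧
      ∀ a : K, a ^ c = 1 → ∃ i < c, η ^ i = a := by
  obtain ⟨p, hp⟩ := CharP.exists K
  rcases CharP.char_is_prime_or_zero K p with hpr | rfl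
  · have := Fact.mk hpr
    obtain ⟨k, m, hm, rfl⟩ := Nat.exists_eq_pow_mul_and_not_dvd hc.ne' p hpr.ne_one
    have : NeZero (m : K) := ⟨fun h => hm ((CharP.cast_eq_zero_iff K p m).1 h)⟩
    have hm0 : m ≠ 0 := fun h => hm (h ▸ dvd_zero p)
    have : NeZero m := ⟨hm0⟩
    obtain ⟨η, hη⟩ := HasEnoughRootsOfUnity.exists_primitiveRoot K m
    refine ⟨η, isRoot_cyclotomic_prime_pow_mul_iff_of_charP.2 hη, fun a ha => ?_⟩
    have ham : a ^ m = 1 := by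
      rw [mul_comm, pow_mul] at ha
      have := ExpChar.prime (R := K) hpr
      apply iterateFrobenius_inj K p k
      simpa [iterateFrobenius_def] using ha
    obtain ⟨i, hi, rfl⟩ := hη.eq_pow_of_pow_eq_one ham
    exact ⟨i, hi.trans_le (Nat.le_mul_of_pos_left _ (pow_pos hpr.pos _)), rfl⟩
  · have := CharP.charP_to_charZero K
    have : NeZero c := ⟨hc.ne'⟩
    have : NeZero (c : K) := NeZero.charZero
    obtain ⟨η, hη⟩ := HasEnoughRootsOfUnity.exists_primitiveRoot K c
    exact ⟨η, isRoot_cyclotomic_iff.2 hη, fun a ha => hη.eq_pow_of_pow_eq_one ha⟩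

lemma eigen_pow {K : Type*} [Field K] [IsAlgClosed K]
    (g : Matrix (Fin 2 ⊕ Fin 2) (Fin 2 ⊕ Fin 2) K) (c : ℕ) (hgc : g ^ c = 1) (a : K)
    (ha : g.charpoly.IsRoot a) : a ^ c = 1 := by
  have h := spectrum.pow_mem_pow g c (Matrix.mem_spectrum_iff_isRoot_charpoly.2 ha)
  rw [hgc, spectrum.one_eq] at h
  exact h

lemma sp4_eigen {K : Type*} [Field K] [IsAlgClosed K]
    (g : Matrix (Fin 2 ⊕ Fin 2) (Fin 2 ⊕ Fin 2) K)
    (hg : g ∈ Matrix.symplecticGroup (Fin 2) K) (c : ℕ) (hgc : g ^ c = 1) :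
    ∃ a b : K, a ^ c = 1 ∧ b ^ c = 1 ∧
      g.charpoly.coeff 2 = a * b + a * b⁻¹ + a⁻¹ * b + a⁻¹ * b⁻¹ + 2 := by
  obtain ⟨h0, h4, hdeg, h13⟩ := sp4_charpoly_facts g hg
  have hev : ∀ x, g.charpoly.eval x =
      x ^ 4 + g.charpoly.coeff 3 * x ^ 3 + g.charpoly.coeff 2 * x ^ 2
        + g.charpoly.coeff 3 * x + 1 := by
    intro x
    rw [eval_eq_sum_range, hdeg]
    simp only [Finset.sum_range_succ, Finset.sum_range_zero, h0, h4, h13]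
    ring
  have quad : ∀ s t : K, ∃ x, x ^ 2 + s * x + t = 0 := by
    intro s t
    have hd : (C 1 * X ^ 2 + C s * X + C t).degree = 2 := degree_quadratic one_ne_zero
    obtain ⟨x, hx⟩ := IsAlgClosed.exists_root (C 1 * X ^ 2 + C s * X + C t)
      (by rw [hd]; norm_num)
    exact ⟨x, by simpa using hx⟩
  set e := g.charpoly.coeff 3
  set f := g.charpoly.coeff 2
  obtain ⟨u, hu⟩ := quad e (f - 2)
  obtain ⟨a, ha⟩ := quad (-u) 1
  obtain ⟨b, hb⟩ := quad (e + u) 1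
  have ha0 : a ≠ 0 := by rintro rfl; simp at ha
  have hb0 : b ≠ 0 := by rintro rfl; simp at hb
  refine ⟨a, b, eigen_pow g c hgc a ?_, eigen_pow g c hgc b ?_, ?_⟩
  · rw [IsRoot.def, hev]
    linear_combination (a ^ 2 + (e + u) * a + 1) * ha + a ^ 2 * hu
  · rw [IsRoot.def, hev]
    linear_combination (b ^ 2 - u * b + 1) * hb + b ^ 2 * hu
  · have h1 : a + a⁻¹ = u := by
      field_simp
      linear_combination ha
    have h2 : b + b⁻¹ = -e - u := by
      field_simp
      linear_combination hb
    have : (a + a⁻¹) * (b + b⁻¹) = u * (-e - u) := by rw [h1, h2]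
    linear_combination hu - this

/-- Let `ζ = e^{2πi/c}` and let `Δ` be the least common multiple over
`i, j ∈ ℤ/cℤ` of the minimal polynomials (over `ℤ`) of
`ζ^{i+j} + ζ^{i−j} + ζ^{−i+j} + ζ^{−i−j} + 2`.  Then for every field `F` and
every `g ∈ Sp₄(F)` of order dividing `c` we have `Δ(χ₂(g)) = 0` in `F`, where
`χ₂(g)` is the `T²`-coefficient of the characteristic polynomial of `g`. -/
theorem stmt_10 (c : ℕ) (hc : 0 < c) (Δ : Polynomial ℤ)
    (hdvd : ∀ i j : ZMod c,
      minpoly ℤ (Complex.exp (2 * Real.pi * Complex.I / c) ^ ((i.val : ℤ) + (j.val : ℤ)) +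
        Complex.exp (2 * Real.pi * Complex.I / c) ^ ((i.val : ℤ) - (j.val : ℤ)) +
        Complex.exp (2 * Real.pi * Complex.I / c) ^ (-(i.val : ℤ) + (j.val : ℤ)) +
        Complex.exp (2 * Real.pi * Complex.I / c) ^ (-(i.val : ℤ) - (j.val : ℤ)) + 2) ∣ Δ)
    (hlcm : ∀ Δ' : Polynomial ℤ, (∀ i j : ZMod c,
      minpoly ℤ (Complex.exp (2 * Real.pi * Complex.I / c) ^ ((i.val : ℤ) + (j.val : ℤ)) +
        Complex.exp (2 * Real.pi * Complex.I / c) ^ ((i.val : ℤ) - (j.val : ℤ)) +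
        Complex.exp (2 * Real.pi * Complex.I / c) ^ (-(i.val : ℤ) + (j.val : ℤ)) +
        Complex.exp (2 * Real.pi * Complex.I / c) ^ (-(i.val : ℤ) - (j.val : ℤ)) + 2) ∣ Δ') →
      Δ ∣ Δ')
    (F : Type*) [Field F] (g : Matrix (Fin 2 ⊕ Fin 2) (Fin 2 ⊕ Fin 2) F)
    (hg : g ∈ Matrix.symplecticGroup (Fin 2) F) (hgc : g ^ c = 1) :
    Polynomial.aeval (g.charpoly.coeff 2) Δ = 0 := by
  classical
  have : NeZero c := ⟨hc.ne'⟩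
  let K := AlgebraicClosure F
  let φ : F →+* K := algebraMap F K
  have hg' := SymplecticGroup.map_mem hg φ
  have hgc' : (g.map φ) ^ c = 1 := by
    have := congrArg φ.mapMatrix hgc
    rw [map_pow, map_one] at this
    exact this
  obtain ⟨a, b, ha, hb, hab⟩ := sp4_eigen (g.map φ) hg' c hgc'
  obtain ⟨η, hη, hpow⟩ := cyclotomic_root_exists K c hc
  obtain ⟨i, hi, rfl⟩ := hpow a ha
  obtain ⟨j, hj, rfl⟩ := hpow b hb
  have hηc : η ^ c = 1 := by
    have h1 : (cyclotomic c K) ∣ X ^ c - 1 := cyclotomic.dvd_X_pow_sub_one c K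
    have := hη.dvd h1
    simpa [sub_eq_zero] using this
  have hζ : IsPrimitiveRoot (Complex.exp (2 * Real.pi * Complex.I / c)) c :=
    Complex.isPrimitiveRoot_exp c hc.ne'
  have hd := hdvd (i : ZMod c) (j : ZMod c)
  rw [ZMod.val_cast_of_lt hi, ZMod.val_cast_of_lt hj] at hd
  generalize Complex.exp (2 * Real.pi * Complex.I / c) = ζ at hd hζ
  have hζ0 : ζ ≠ 0 := hζ.ne_zero hc.ne'
  have hη0 : η ≠ 0 := by
    rintro rfl
    simp [hc.ne'] at hηc
  let f : ℤ[X] := X ^ i * X ^ j + X ^ i * X ^ (c - j) + X ^ (c - i) * X ^ j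
    + X ^ (c - i) * X ^ (c - j) + 2
  have hfζ : aeval ζ f = ζ ^ ((i : ℤ) + (j : ℤ)) + ζ ^ ((i : ℤ) - (j : ℤ)) +
        ζ ^ (-(i : ℤ) + (j : ℤ)) + ζ ^ (-(i : ℤ) - (j : ℤ)) + 2 := by
    simp only [f, map_add, map_mul, map_pow, aeval_X, map_ofNat]
    rw [pow_sub₀ _ hζ0 hi.le, pow_sub₀ _ hζ0 hj.le, hζ.pow_eq_one]
    simp only [zpow_add₀ hζ0, zpow_sub₀ hζ0, zpow_neg, zpow_natCast, one_mul, div_eq_mul_inv]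
  have hfη : aeval η f = φ (g.charpoly.coeff 2) := by
    rw [Matrix.charpoly_map, coeff_map] at hab
    rw [hab]
    simp only [f, map_add, map_mul, map_pow, aeval_X, map_ofNat]
    rw [pow_sub₀ _ hη0 hi.le, pow_sub₀ _ hη0 hj.le, hηc]
    simp only [one_mul]
  rw [← hfζ] at hd
  have hΔ : aeval (aeval ζ f) Δ = 0 := by
    obtain ⟨q, rfl⟩ := hd
    rw [map_mul, minpoly.aeval, zero_mul]
  rw [← aeval_comp] at hΔ
  have hcyc : cyclotomic c ℤ ∣ Δ.comp f := by
    rw [cyclotomic_eq_minpoly hζ hc]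
    exact minpoly.isIntegrallyClosed_dvd (hζ.isIntegral hc) hΔ
  have hfin : aeval (φ (g.charpoly.coeff 2)) Δ = 0 := by
    rw [← hfη, ← aeval_comp]
    obtain ⟨q, hq⟩ := hcyc
    have h0 : aeval η (cyclotomic c ℤ) = 0 := by
      rw [aeval_def, ← eval_map, map_cyclotomic]
      exact hη
    rw [hq, map_mul, h0, zero_mul]
  apply φ.injective
  rw [map_zero, ← hfin]
  simp only [aeval_def, hom_eval₂]
  congr 1
end

section
/- Let F be an algebraically closed field of characteristic ≠ 3, and let g₁, g₂ ∈ Sp₄(F) be elements of order 3 generating an absolutely irreducible subgroup. Then, setting t₁₂ = tr(g₁g₂), t₁₋₂ = tr(g₁g₂⁻¹), c₁₂ = χ₂(g₁g₂), the relation (t₁₋₂ + t₁₂ + 1)·(t₁₋₂² + (2t₁₂ − 10)t₁₋₂ + t₁₂² − 9c₁₂ + 8t₁₂ + 7) = 0 holds in F. -/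
open Matrix

abbrev I4 := Fin 2 ⊕ Fin 2

/-- the symplectic form -/
def om {F : Type*} [Field F] (x y : I4 → F) : F := x ⬝ᵥ (Matrix.J (Fin 2) F *ᵥ y)

section
set_option linter.unusedSimpArgs false
variable {F : Type*} [Field F]

lemma om_eq (x y : I4 → F) : om x y =
    - x (.inl 0) * y (.inr 0) - x (.inl 1) * y (.inr 1) + x (.inr 0) * y (.inl 0)
      + x (.inr 1) * y (.inl 1) := by
  simp [om, Matrix.J, dotProduct, mulVec, Fintype.sum_sum_type, Matrix.fromBlocks, Matrix.one_apply]
  ring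

lemma om_add_left (x y z : I4 → F) : om (x + y) z = om x z + om y z := by
  simp [om_eq]; ring
lemma om_add_right (x y z : I4 → F) : om x (y + z) = om x y + om x z := by
  simp [om_eq]; ring
lemma om_smul_left (c : F) (x z : I4 → F) : om (c • x) z = c * om x z := by
  simp [om_eq]; ring
lemma om_smul_right (c : F) (x z : I4 → F) : om x (c • z) = c * om x z := by
  simp [om_eq]; ring
lemma om_neg (x z : I4 → F) : om x z = - om z x := by
  simp [om_eq]; ring
lemma om_sub_left (x y z : I4 → F) : om (x - y) z = om x z - om y z := by
  simp [om_eq]; ring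
lemma om_sub_right (x y z : I4 → F) : om x (y - z) = om x y - om x z := by
  simp [om_eq]; ring
lemma om_neg_left (x z : I4 → F) : om (-x) z = - om x z := by
  simp [om_eq]; ring
lemma om_self (x : I4 → F) : om x x = 0 := by
  simp [om_eq]; ring

lemma om_g {g : Matrix I4 I4 F} (hg : g ∈ symplecticGroup (Fin 2) F) (x y : I4 → F) :
    om (g *ᵥ x) (g *ᵥ y) = om x y := by
  have h := SymplecticGroup.mem_iff'.1 hg
  unfold om
  conv_rhs => rw [← h]
  simp only [← mulVec_mulVec, dotProduct_mulVec, vecMul_transpose]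

lemma om_nondeg (x : I4 → F) (h : ∀ y, om x y = 0) : x = 0 := by
  ext i
  rcases i with i | i <;> fin_cases i
  · simpa [om_eq] using h (Pi.single (.inr 0) 1)
  · simpa [om_eq] using h (Pi.single (.inr 1) 1)
  · simpa [om_eq] using h (Pi.single (.inl 0) 1)
  · simpa [om_eq] using h (Pi.single (.inl 1) 1)

/-- matrix with given four columns -/
def colsM (a b c d : I4 → F) : Matrix I4 I4 F := fun i j => Sum.elim ![a, b] ![c, d] j i

lemma colsM_mulVec (a b c d x : I4 → F) : colsM a b c d *ᵥ x =
    x (.inl 0) • a + x (.inl 1) • b + x (.inr 0) • c + x (.inr 1) • d := by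
  ext i
  simp [colsM, mulVec, dotProduct, Fintype.sum_sum_type]
  ring

lemma mulVec_eq_zero' (M : Matrix I4 I4 F) (h : ∀ x y, om x (M *ᵥ y) = 0) : M = 0 := by
  apply Matrix.ext_of_mulVec_single
  intro i
  rw [zero_mulVec]
  apply om_nondeg
  intro y
  rw [om_neg, h, neg_zero]

lemma exists_u [IsAlgClosed F] (h3 : (3 : F) ≠ 0) {g : Matrix I4 I4 F}
    (hg : g ∈ symplecticGroup (Fin 2) F) (h : g ^ 3 = 1) (h' : g ≠ 1) :
    ∃ u, g *ᵥ (g *ᵥ u) = - u - g *ᵥ u ∧ om u (g *ᵥ u) = 1 := by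
  have hggg : ∀ x, g *ᵥ (g *ᵥ (g *ᵥ x)) = x := by
    intro x
    rw [mulVec_mulVec, mulVec_mulVec, ← pow_three', h, one_mulVec]
  have key : ∃ w, om (g *ᵥ w - w) (g *ᵥ (g *ᵥ w - w)) ≠ 0 := by
    by_contra! hc
    apply h'
    have : (3 : F) • (g - 1) = 0 := by
      apply mulVec_eq_zero'
      intro x y
      have e := hc (g *ᵥ x + y)
      have e1 := hc (g *ᵥ x)
      have e2 := hc y
      have s1 := om_g hg
      have a1 := s1 x (g *ᵥ y)
      have a3 := s1 x y
      have a5 := s1 (g *ᵥ x) (g *ᵥ y)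
      have a6 : om (g *ᵥ g *ᵥ x) y = om x (g *ᵥ y) := by
        rw [← s1 (g *ᵥ g *ᵥ x) y, hggg]
      have a7 : om (g *ᵥ g *ᵥ x) (g *ᵥ y) = om (g *ᵥ x) y := s1 (g *ᵥ x) y
      have b3 := om_neg (g *ᵥ y) x
      have b5 := om_neg (g *ᵥ y) (g *ᵥ (g *ᵥ x))
      have b6 := om_neg y (g *ᵥ (g *ᵥ x))
      have b1 := om_neg y x
      simp only [mulVec_add, mulVec_sub, om_sub_left, om_sub_right, om_add_left,
        om_add_right, hggg] at e e1 e2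
      rw [b3, b5, b6, b1, a6, a7, a5, a1, a3] at e
      simp only [smul_mulVec, sub_mulVec, one_mulVec, om_smul_right, om_sub_right]
      linear_combination (-1 : F) * (e - e1 - e2)
    have := (smul_eq_zero.1 this).resolve_left h3
    exact sub_eq_zero.1 this
  obtain ⟨w, hw⟩ := key
  obtain ⟨r, hr⟩ := IsAlgClosed.exists_pow_nat_eq (om (g *ᵥ w - w) (g *ᵥ (g *ᵥ w - w)))⁻¹ (n := 2) (by norm_num)
  refine ⟨r • (g *ᵥ w - w), ?_, ?_⟩
  · simp only [mulVec_smul, mulVec_sub, hggg]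
    module
  · rw [mulVec_smul, om_smul_left, om_smul_right, ← mul_assoc, ← pow_two, hr, inv_mul_cancel₀ hw]

lemma normal_form [IsAlgClosed F] (h3 : (3 : F) ≠ 0) {g : Matrix I4 I4 F}
    (hg : g ∈ symplecticGroup (Fin 2) F) (h : g ^ 3 = 1) (h' : g ≠ 1)
    (hE : g ^ 2 + g + 1 ≠ 0) :
    ∃ u v, om u v = 1 ∧ ∀ x, g *ᵥ x = x + om x v • (v - u) + om u x • (- u - (2 : F) • v) := by
  obtain ⟨u, hu, huv⟩ := exists_u h3 hg h h'
  have hggg : ∀ x, g *ᵥ (g *ᵥ (g *ᵥ x)) = x := by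
    intro x
    rw [mulVec_mulVec, mulVec_mulVec, ← pow_three', h, one_mulVec]
  have hz : ∃ z, g *ᵥ (g *ᵥ z) + g *ᵥ z + z ≠ 0 := by
    by_contra! hc
    apply hE
    apply Matrix.ext_of_mulVec_single
    intro i
    rw [zero_mulVec, add_mulVec, add_mulVec, one_mulVec, pow_two, ← mulVec_mulVec, hc]
  obtain ⟨z, hz⟩ := hz
  obtain ⟨f, hf⟩ : ∃ f, f = g *ᵥ (g *ᵥ z) + g *ᵥ z + z := ⟨_, rfl⟩
  rw [← hf] at hz
  have hgf : g *ᵥ f = f := by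
    rw [hf]; simp only [mulVec_add, hggg]; abel
  have s := om_g hg
  obtain ⟨y, hy⟩ : ∃ y, om f y ≠ 0 := by
    by_contra! hc
    exact hz (om_nondeg f hc)
  obtain ⟨k, hk⟩ : ∃ k, k = g *ᵥ (g *ᵥ y) + g *ᵥ y + y := ⟨_, rfl⟩
  have hgk : g *ᵥ k = k := by
    rw [hk]; simp only [mulVec_add, hggg]; abel
  have hfk : om f k ≠ 0 := by
    have a1 := s f y
    have a2 := s f (g *ᵥ y)
    rw [hgf] at a1 a2
    rw [hk, om_add_right, om_add_right, a2, a1]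
    intro e
    apply hy
    have : 3 * om f y = 0 := by linear_combination e
    exact (mul_eq_zero.1 this).resolve_left h3
  obtain ⟨v, hv⟩ : ∃ v, v = g *ᵥ u := ⟨_, rfl⟩
  rw [← hv] at hu huv
  have perp : ∀ p, g *ᵥ p = p → om u p = 0 ∧ om v p = 0 := by
    intro p hp
    have a1 := s u p
    have a2 := s v p
    rw [hp, ← hv] at a1
    rw [hp, hu] at a2
    simp only [om_sub_left, om_neg_left] at a2
    have : 3 * om u p = 0 := by linear_combination -a2 -2 * a1
    have := (mul_eq_zero.1 this).resolve_left h3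
    exact ⟨this, by rw [a1, this]⟩
  obtain ⟨uf, vf⟩ := perp f hgf
  obtain ⟨uk, vk⟩ := perp k hgk
  have fu := om_neg f u
  have fv := om_neg f v
  have ku := om_neg k u
  have kv := om_neg k v
  have vu := om_neg v u
  rw [uf, neg_zero] at fu
  rw [vf, neg_zero] at fv
  rw [uk, neg_zero] at ku
  rw [vk, neg_zero] at kv
  rw [huv] at vu
  have kf := om_neg k f
  have hB : (colsM u v f k).det ≠ 0 := by
    intro hd
    obtain ⟨c, hc, hc0⟩ := Matrix.exists_mulVec_eq_zero_iff.2 hd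
    rw [colsM_mulVec] at hc0
    have z1 := congrArg (om u) hc0
    have z2 := congrArg (om v) hc0
    have z3 := congrArg (om f) hc0
    have z4 := congrArg (om k) hc0
    have o0 : ∀ x : I4 → F, om x 0 = 0 := fun x => by simp [om_eq]
    simp only [om_add_right, om_smul_right, om_self, uf, vf, uk, vk, fu, fv, ku, kv, vu, huv, o0, kf] at z1 z2 z3 z4
    apply hc
    have : om f k ≠ 0 := hfk
    simp [hfk] at z1 z2 z3 z4
    ext i
    rcases i with i | i <;> fin_cases i <;> simp [*]
  refine ⟨u, v, huv, ?_⟩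
  intro x
  obtain ⟨c, rfl⟩ : ∃ c, x = colsM u v f k *ᵥ c :=
    ⟨(colsM u v f k)⁻¹ *ᵥ x, by rw [mulVec_mulVec, mul_nonsing_inv _ (isUnit_iff_ne_zero.2 hB), one_mulVec]⟩
  rw [colsM_mulVec]
  simp only [mulVec_add, mulVec_smul, om_add_right, om_smul_right, om_add_left, om_smul_left, om_self, uf, vf, uk, vk, fu, fv, ku, kv, vu, huv, ← hv, hu, hgf, hgk]
  module

lemma coeff_two (M : Matrix (Fin 4) (Fin 4) F) : M.charpoly.coeff 2 =
    (M 0 0 * M 1 1 - M 0 1 * M 1 0) + (M 0 0 * M 2 2 - M 0 2 * M 2 0) + (M 0 0 * M 3 3 - M 0 3 * M 3 0)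
    + (M 1 1 * M 2 2 - M 1 2 * M 2 1) + (M 1 1 * M 3 3 - M 1 3 * M 3 1) + (M 2 2 * M 3 3 - M 2 3 * M 3 2) := by
  have : ∃ a b c : F, M.charpoly = Polynomial.X ^ 4 + Polynomial.C a * Polynomial.X ^ 3 + Polynomial.C ((M 0 0 * M 1 1 - M 0 1 * M 1 0) + (M 0 0 * M 2 2 - M 0 2 * M 2 0) + (M 0 0 * M 3 3 - M 0 3 * M 3 0)
    + (M 1 1 * M 2 2 - M 1 2 * M 2 1) + (M 1 1 * M 3 3 - M 1 3 * M 3 1) + (M 2 2 * M 3 3 - M 2 3 * M 3 2)) * Polynomial.X ^ 2 + Polynomial.C b * Polynomial.X + Polynomial.C c := by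
    refine ⟨-(M 0 0 + M 1 1 + M 2 2 + M 3 3),
      -((M.submatrix ![0,1,2] ![0,1,2]).det + (M.submatrix ![0,1,3] ![0,1,3]).det
        + (M.submatrix ![0,2,3] ![0,2,3]).det + (M.submatrix ![1,2,3] ![1,2,3]).det), M.det, ?_⟩
    have e4 : ∀ {R : Type _} [CommRing R] (N : Matrix (Fin 4) (Fin 4) R), N.det =
      N 0 0 * (N 1 1 * (N 2 2 * N 3 3 - N 2 3 * N 3 2) - N 1 2 * (N 2 1 * N 3 3 - N 2 3 * N 3 1) + N 1 3 * (N 2 1 * N 3 2 - N 2 2 * N 3 1))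
      - N 0 1 * (N 1 0 * (N 2 2 * N 3 3 - N 2 3 * N 3 2) - N 1 2 * (N 2 0 * N 3 3 - N 2 3 * N 3 0) + N 1 3 * (N 2 0 * N 3 2 - N 2 2 * N 3 0))
      + N 0 2 * (N 1 0 * (N 2 1 * N 3 3 - N 2 3 * N 3 1) - N 1 1 * (N 2 0 * N 3 3 - N 2 3 * N 3 0) + N 1 3 * (N 2 0 * N 3 1 - N 2 1 * N 3 0))
      - N 0 3 * (N 1 0 * (N 2 1 * N 3 2 - N 2 2 * N 3 1) - N 1 1 * (N 2 0 * N 3 2 - N 2 2 * N 3 0) + N 1 2 * (N 2 0 * N 3 1 - N 2 1 * N 3 0)) := by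
      intro R _ N
      rw [det_succ_row_zero]
      simp [Fin.sum_univ_succ, det_fin_three, Fin.succAbove]
      ring
    rw [Matrix.charpoly, e4, e4 M]
    simp only [det_fin_three, submatrix_apply, Matrix.cons_val]
    simp [charmatrix_apply, Matrix.one_apply]
    ring
  obtain ⟨a, b, c, h⟩ := this
  rw [h]
  simp only [Polynomial.coeff_add, Polynomial.coeff_C_mul, Polynomial.coeff_X, Polynomial.coeff_C, Polynomial.coeff_X_pow]
  norm_num

lemma adjoin_top_ne {g₁ g₂ : Matrix I4 I4 F} (hirr : Algebra.adjoin F {g₁, g₂} = ⊤)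
    (y : I4 → F) (h1 : y ᵥ* g₁ = y) (h2 : y ᵥ* g₂ = y) : y = 0 := by
  have key : ∀ M : Matrix I4 I4 F, ∃ c : F, y ᵥ* M = c • y := by
    intro M
    have hM : M ∈ Algebra.adjoin F {g₁, g₂} := by rw [hirr]; trivial
    induction hM using Algebra.adjoin_induction with
    | mem x hx =>
      rcases hx with rfl | rfl
      · exact ⟨1, by simp [h1]⟩
      · exact ⟨1, by simp [h2]⟩
    | algebraMap r => exact ⟨r, by rw [Algebra.algebraMap_eq_smul_one, vecMul_smul, vecMul_one]⟩
    | add a b _ _ ha hb =>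
      obtain ⟨c, hc⟩ := ha
      obtain ⟨d, hd⟩ := hb
      exact ⟨c + d, by rw [vecMul_add, hc, hd, add_smul]⟩
    | mul a b _ _ ha hb =>
      obtain ⟨c, hc⟩ := ha
      obtain ⟨d, hd⟩ := hb
      exact ⟨c * d, by rw [← vecMul_vecMul, hc, smul_vecMul, hd, smul_smul]⟩
  ext i
  by_contra hi
  obtain ⟨j, hj⟩ : ∃ j, j ≠ i := Fintype.exists_ne_of_one_lt_card (by simp) i
  obtain ⟨c, hc⟩ := key (Matrix.single i j 1)
  have ei := congrFun hc i
  have ej := congrFun hc j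
  simp [vecMul, dotProduct, Matrix.single_apply, hj, hj.symm] at ei ej hi
  simp_all

lemma quad_case {g₁ g₂ : Matrix I4 I4 F} (hirr : Algebra.adjoin F {g₁, g₂} = ⊤)
    (h1 : g₁ ^ 2 + g₁ + 1 = 0) (h2 : g₂ ^ 2 + g₂ + 1 = 0) : False := by
  classical
  have q1 : g₁ * g₁ = - g₁ - 1 := by
    rw [← pow_two, ← sub_eq_zero, ← h1]; abel
  have q2 : g₂ * g₂ = - g₂ - 1 := by
    rw [← pow_two, ← sub_eq_zero, ← h2]; abel
  have q1' : ∀ x, g₁ * (g₁ * x) = - g₁ * x - x := fun x => by rw [← mul_assoc, q1]; noncomm_ring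
  have q2' : ∀ x, g₂ * (g₂ * x) = - g₂ * x - x := fun x => by rw [← mul_assoc, q2]; noncomm_ring
  obtain ⟨z, hz⟩ : ∃ z, z = g₁ + g₂ + g₁ * g₂ + g₂ * g₁ := ⟨_, rfl⟩
  have c1 : Commute z g₁ := by
    rw [hz]; simp only [Commute, SemiconjBy, mul_add, add_mul, mul_assoc, q1, q1']; noncomm_ring
  have c2 : Commute z g₂ := by
    rw [hz]; simp only [Commute, SemiconjBy, mul_add, add_mul, mul_assoc, q2, q2']; noncomm_ring
  have hc : ∀ M, Commute z M := by
    intro M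
    have hM : M ∈ Algebra.adjoin F {g₁, g₂} := by rw [hirr]; trivial
    induction hM using Algebra.adjoin_induction with
    | mem x hx =>
      rcases hx with rfl | rfl
      · exact c1
      · exact c2
    | algebraMap r => exact (Algebra.commutes r z).symm
    | add a b _ _ ha hb => exact ha.add_right hb
    | mul a b _ _ ha hb => exact ha.mul_right hb
  obtain ⟨l, hl⟩ := Matrix.mem_range_scalar_of_commute_single (M := z) (fun i j _ => (hc _).symm)
  have hl : z = l • 1 := by rw [← hl, Matrix.scalar_apply, Matrix.smul_one_eq_diagonal]
  have h21 : g₂ * g₁ = l • 1 - g₁ - g₂ - g₁ * g₂ := by rw [← hl, hz]; abel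
  let S : Submodule F (Matrix I4 I4 F) := Submodule.span F (Finset.image ![1, g₁, g₂, g₁ * g₂] Finset.univ : Finset _)
  have m0 : (1 : Matrix I4 I4 F) ∈ S := Submodule.subset_span (by simp)
  have m1 : g₁ ∈ S := Submodule.subset_span (by simp [Fin.exists_fin_succ])
  have m2 : g₂ ∈ S := Submodule.subset_span (by simp [Fin.exists_fin_succ])
  have m3 : g₁ * g₂ ∈ S := Submodule.subset_span (by simp [Fin.exists_fin_succ])
  have gen : ∀ g : Matrix I4 I4 F, g ∈ S → g * g₁ ∈ S → g * g₂ ∈ S → g * (g₁ * g₂) ∈ S → ∀ x ∈ S, g * x ∈ S := by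
    intro g a0 a1 a2 a3 x hx
    have : S ≤ S.comap (LinearMap.mulLeft F g) := by
      apply Submodule.span_le.2
      intro y hy
      simp [Fin.exists_fin_succ] at hy
      rcases hy with rfl | rfl | rfl | rfl <;> simpa
    exact this hx
  have L1 : ∀ x ∈ S, g₁ * x ∈ S := by
    apply gen
    · exact m1
    · rw [q1]; exact S.sub_mem (S.neg_mem m1) m0
    · exact m3
    · rw [q1']; exact S.sub_mem (by rw [neg_mul]; exact S.neg_mem m3) m2
  have L2 : ∀ x ∈ S, g₂ * x ∈ S := by
    apply gen
    · exact m2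
    · rw [h21]; exact S.sub_mem (S.sub_mem (S.sub_mem (S.smul_mem _ m0) m1) m2) m3
    · rw [q2]; exact S.sub_mem (S.neg_mem m2) m0
    · have : g₂ * (g₁ * g₂) = l • g₂ - g₁ * g₂ + (g₂ + 1) + (g₁ * g₂ + g₁) := by
        rw [← mul_assoc, h21]
        simp only [sub_mul, mul_assoc, q2, smul_mul_assoc, one_mul]
        noncomm_ring
      rw [this]
      exact S.add_mem (S.add_mem (S.sub_mem (S.smul_mem _ m2) m3) (S.add_mem m2 m0)) (S.add_mem m3 m1)
  have LM : ∀ M : Matrix I4 I4 F, ∀ x ∈ S, M * x ∈ S := by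
    intro M
    have hM : M ∈ Algebra.adjoin F {g₁, g₂} := by rw [hirr]; trivial
    induction hM using Algebra.adjoin_induction with
    | mem x hx =>
      rcases hx with rfl | rfl
      · exact L1
      · exact L2
    | algebraMap r => intro x hx; rw [← Algebra.smul_def]; exact S.smul_mem _ hx
    | add a b _ _ ha hb => intro x hx; rw [add_mul]; exact S.add_mem (ha x hx) (hb x hx)
    | mul a b _ _ ha hb => intro x hx; rw [mul_assoc]; exact ha _ (hb _ hx)
  have top : S = ⊤ := by
    rw [eq_top_iff]
    intro M _
    simpa using LM M 1 m0
  have r1 : Module.finrank F S ≤ 4 :=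
    (finrank_span_finset_le_card _).trans (Finset.card_image_le.trans (by simp))
  rw [top, finrank_top, Module.finrank_matrix] at r1
  simp at r1

lemma trace_one {g : Matrix I4 I4 F} {u v : I4 → F} (huv : om u v = 1)
    (hg : ∀ x, g *ᵥ x = x + om x v • (v - u) + om u x • (- u - (2 : F) • v)) : g.trace = 1 := by
  have e : ∀ i, g i i = (g *ᵥ Pi.single i 1) i := by intro i; simp
  simp only [Matrix.trace, Matrix.diag, e, hg]
  simp [Fintype.sum_sum_type, om_eq] at huv ⊢
  linear_combination (-3 : F) * huv

lemma trace_inv {g : Matrix I4 I4 F} (hg : g ∈ symplecticGroup (Fin 2) F) (k : Matrix I4 I4 F)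
    (hk : g * k = 1) : k.trace = g.trace := by
  have h := SymplecticGroup.mem_iff'.1 hg
  have hJ : Matrix.J (Fin 2) F * Matrix.J (Fin 2) F = -1 := Matrix.J_squared _ _
  have : Matrix.J (Fin 2) F * k = gᵀ * Matrix.J (Fin 2) F := by
    rw [← h, mul_assoc, mul_assoc, hk, mul_one, h]
  have h2 : k = - (Matrix.J (Fin 2) F * (gᵀ * Matrix.J (Fin 2) F)) := by
    rw [← this, ← mul_assoc, hJ]; simp
  rw [h2, trace_neg, trace_mul_comm, mul_assoc, hJ]
  simp

lemma adjoin_det {g₁ g₂ : Matrix I4 I4 F} (hirr : Algebra.adjoin F {g₁, g₂} = ⊤)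
    {u₁ v₁ u₂ v₂ : I4 → F}
    (hg₁ : ∀ x, g₁ *ᵥ x = x + om x v₁ • (v₁ - u₁) + om u₁ x • (- u₁ - (2 : F) • v₁))
    (hg₂ : ∀ x, g₂ *ᵥ x = x + om x v₂ • (v₂ - u₂) + om u₂ x • (- u₂ - (2 : F) • v₂)) :
    (colsM u₁ v₁ u₂ v₂).det ≠ 0 := by
  intro hd
  obtain ⟨y, hy, h0⟩ := Matrix.exists_vecMul_eq_zero_iff.2 hd
  have z1 : y ⬝ᵥ u₁ = 0 := congrFun h0 (.inl 0)
  have z2 : y ⬝ᵥ v₁ = 0 := congrFun h0 (.inl 1)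
  have z3 : y ⬝ᵥ u₂ = 0 := congrFun h0 (.inr 0)
  have z4 : y ⬝ᵥ v₂ = 0 := congrFun h0 (.inr 1)
  apply hy
  have gen : ∀ g : Matrix I4 I4 F, (∀ x, y ⬝ᵥ (g *ᵥ x) = y ⬝ᵥ x) → y ᵥ* g = y := by
    intro g h
    ext i
    have := h (Pi.single i 1)
    rw [dotProduct_mulVec] at this
    simpa using this
  apply adjoin_top_ne hirr
  · apply gen
    intro x
    simp [hg₁, dotProduct_add, dotProduct_sub, dotProduct_smul, z1, z2]
  · apply gen
    intro x
    simp [hg₂, dotProduct_add, dotProduct_sub, dotProduct_smul, z3, z4]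

lemma poly_id {M₁ M₂ : Matrix I4 I4 F} {a b c d : F}
    (h₁ : M₁ = colsM (Sum.elim ![0, 1] ![0, 0]) (Sum.elim ![-1, -1] ![0, 0])
      (Sum.elim ![c - a, -c - 2 * a] ![1, 0]) (Sum.elim ![d - b, -d - 2 * b] ![0, 1]))
    (h₂ : M₂ = colsM (Sum.elim ![1, 0] ![a - b, b + 2 * a]) (Sum.elim ![0, 1] ![c - d, d + 2 * c])
      (Sum.elim ![0, 0] ![0, 1]) (Sum.elim ![0, 0] ![-1, -1])) :
      (Matrix.trace (M₁ * (M₂ * M₂)) ^ 2 +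
        (2 * Matrix.trace (M₁ * M₂) - 10) * Matrix.trace (M₁ * (M₂ * M₂)) +
        Matrix.trace (M₁ * M₂) ^ 2 - 9 * (M₁ * M₂).charpoly.coeff 2 +
        8 * Matrix.trace (M₁ * M₂) + 7) = 0 := by
  have e := Matrix.charpoly_reindex (finSumFinEquiv (m := 2) (n := 2)) (M₁ * M₂)
  rw [← e, coeff_two]
  have i0 : (finSumFinEquiv (m := 2) (n := 2)).symm 0 = .inl 0 := rfl
  have i1 : (finSumFinEquiv (m := 2) (n := 2)).symm 1 = .inl 1 := rfl
  have i2 : (finSumFinEquiv (m := 2) (n := 2)).symm 2 = .inr 0 := rfl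
  have i3 : (finSumFinEquiv (m := 2) (n := 2)).symm 3 = .inr 1 := rfl
  simp only [reindex_apply, submatrix_apply, i0, i1, i2, i3]
  subst h₁ h₂
  simp [Matrix.trace, Matrix.mul_apply, Fintype.sum_sum_type, colsM]
  ring

lemma case_a {g₁ g₂ : Matrix I4 I4 F} (hirr : Algebra.adjoin F {g₁, g₂} = ⊤)
    {u₁ v₁ u₂ v₂ : I4 → F} (h₁ : om u₁ v₁ = 1) (h₂ : om u₂ v₂ = 1)
    (hg₁ : ∀ x, g₁ *ᵥ x = x + om x v₁ • (v₁ - u₁) + om u₁ x • (- u₁ - (2 : F) • v₁))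
    (hg₂ : ∀ x, g₂ *ᵥ x = x + om x v₂ • (v₂ - u₂) + om u₂ x • (- u₂ - (2 : F) • v₂)) :
      (Matrix.trace (g₁ * (g₂ * g₂)) ^ 2 +
        (2 * Matrix.trace (g₁ * g₂) - 10) * Matrix.trace (g₁ * (g₂ * g₂)) +
        Matrix.trace (g₁ * g₂) ^ 2 - 9 * (g₁ * g₂).charpoly.coeff 2 +
        8 * Matrix.trace (g₁ * g₂) + 7) = 0 := by
  have hB := adjoin_det hirr hg₁ hg₂
  obtain ⟨B, hBd⟩ : ∃ B, B = colsM u₁ v₁ u₂ v₂ := ⟨_, rfl⟩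
  rw [← hBd] at hB
  have hcol : ∀ (g : Matrix I4 I4 F) (p q r s : I4 → F), g * colsM p q r s =
      colsM (g *ᵥ p) (g *ᵥ q) (g *ᵥ r) (g *ᵥ s) := by
    intro g p q r s
    ext i j
    rcases j with j | j <;> fin_cases j <;> rfl
  obtain ⟨M₁, hM₁⟩ : ∃ M : Matrix I4 I4 F, M = colsM (Sum.elim ![0, 1] ![0, 0]) (Sum.elim ![-1, -1] ![0, 0])
      (Sum.elim ![om v₁ u₂ - om u₁ u₂, -om v₁ u₂ - 2 * om u₁ u₂] ![1, 0])
      (Sum.elim ![om v₁ v₂ - om u₁ v₂, -om v₁ v₂ - 2 * om u₁ v₂] ![0, 1]) := ⟨_, rfl⟩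
  obtain ⟨M₂, hM₂⟩ : ∃ M : Matrix I4 I4 F, M = colsM (Sum.elim ![1, 0] ![om u₁ u₂ - om u₁ v₂, om u₁ v₂ + 2 * om u₁ u₂])
      (Sum.elim ![0, 1] ![om v₁ u₂ - om v₁ v₂, om v₁ v₂ + 2 * om v₁ u₂])
      (Sum.elim ![0, 0] ![0, 1]) (Sum.elim ![0, 0] ![-1, -1]) := ⟨_, rfl⟩
  have key := poly_id hM₁ hM₂
  have e1 : g₁ * B = B * M₁ := by
    rw [hM₁, hcol, hBd, hcol]
    simp only [colsM_mulVec, hg₁, h₁, om_self, om_neg u₂ v₁, om_neg v₂ v₁, Sum.elim_inl,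
      Sum.elim_inr, Matrix.cons_val_zero, Matrix.cons_val_one]
    congr 1 <;> module
  have e2 : g₂ * B = B * M₂ := by
    rw [hM₂, hcol, hBd, hcol]
    simp only [colsM_mulVec, hg₂, h₂, om_self, om_neg u₂ v₁, om_neg u₂ u₁, Sum.elim_inl,
      Sum.elim_inr, Matrix.cons_val_zero, Matrix.cons_val_one]
    congr 1 <;> module
  have hu : IsUnit B.det := isUnit_iff_ne_zero.2 hB
  have f1 : g₁ = B * M₁ * B⁻¹ := by rw [← e1, mul_nonsing_inv_cancel_right _ _ hu]
  have f2 : g₂ = B * M₂ * B⁻¹ := by rw [← e2, mul_nonsing_inv_cancel_right _ _ hu]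
  have f12 : g₁ * g₂ = B * (M₁ * M₂) * B⁻¹ := by
    rw [← mul_assoc, ← e1, mul_assoc g₁, mul_assoc g₁, ← e2, mul_nonsing_inv_cancel_right _ _ hu]
  have f122 : g₁ * (g₂ * g₂) = B * (M₁ * (M₂ * M₂)) * B⁻¹ := by
    rw [← mul_assoc g₁, f12, f2]
    have : B * (M₁ * M₂) * B⁻¹ * (B * M₂ * B⁻¹) = B * (M₁ * M₂) * (B⁻¹ * B) * (M₂ * B⁻¹) := by
      simp only [mul_assoc]
    rw [this, nonsing_inv_mul _ hu, mul_one]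
    simp only [mul_assoc]
  have tr : ∀ M, (B * M * B⁻¹).trace = M.trace := by
    intro M
    rw [trace_mul_comm, ← mul_assoc, nonsing_inv_mul _ hu, one_mul]
  have cp : ∀ M, (B * M * B⁻¹).charpoly = M.charpoly := by
    intro M
    rw [mul_assoc, charpoly_mul_comm, mul_assoc, nonsing_inv_mul _ hu, mul_one]
  rw [f12, f122, tr, tr, cp]
  exact key

end

theorem stmt_11 {F : Type*} [Field F] [IsAlgClosed F] (hchar : ringChar F ≠ 3)
    (g₁ g₂ : Matrix (Fin 2 ⊕ Fin 2) (Fin 2 ⊕ Fin 2) F)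
    (hg₁ : g₁ ∈ Matrix.symplecticGroup (Fin 2) F)
    (hg₂ : g₂ ∈ Matrix.symplecticGroup (Fin 2) F)
    (h₁ : g₁ ^ 3 = 1) (h₁' : g₁ ≠ 1) (h₂ : g₂ ^ 3 = 1) (h₂' : g₂ ≠ 1)
    (hirr : Algebra.adjoin F {g₁, g₂} = ⊤) :
    (Matrix.trace (g₁ * g₂⁻¹) + Matrix.trace (g₁ * g₂) + 1) *
      (Matrix.trace (g₁ * g₂⁻¹) ^ 2 +
        (2 * Matrix.trace (g₁ * g₂) - 10) * Matrix.trace (g₁ * g₂⁻¹) +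
        Matrix.trace (g₁ * g₂) ^ 2 - 9 * (g₁ * g₂).charpoly.coeff 2 +
        8 * Matrix.trace (g₁ * g₂) + 7) = 0 := by
  have h3 : (3 : F) ≠ 0 := by
    intro h
    apply hchar
    have : ringChar F ∣ 3 := (ringChar.spec F 3).1 (by exact_mod_cast h)
    rcases (Nat.dvd_prime Nat.prime_three).1 this with h' | h'
    · have := (ringChar.spec F 1).2 (by rw [h'])
      simp at this
    · exact h'
  have hinv : g₂⁻¹ = g₂ * g₂ := by
    apply Matrix.inv_eq_left_inv
    rw [← h₂, pow_three']
  rw [hinv]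
  by_cases E1 : g₁ ^ 2 + g₁ + 1 = 0
  · by_cases E2 : g₂ ^ 2 + g₂ + 1 = 0
    · exact (quad_case hirr E1 E2).elim
    · obtain ⟨u, v, huv, hf⟩ := normal_form h3 hg₂ h₂ h₂' E2
      have t := trace_one huv hf
      have hm : g₁ * (g₂ * g₂) ∈ symplecticGroup (Fin 2) F := mul_mem hg₁ (mul_mem hg₂ hg₂)
      have ti := trace_inv hm (g₂ * (g₁ * g₁)) (by
        have : g₁ * (g₂ * g₂) * (g₂ * (g₁ * g₁)) = g₁ * (g₂ ^ 3) * (g₁ * g₁) := by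
          rw [pow_three']; simp only [mul_assoc]
        rw [this, h₂, mul_one, ← h₁, pow_three])
      have : g₂ * (g₁ * g₁) + g₂ * g₁ + g₂ = 0 := by
        rw [← mul_zero g₂, ← E1, pow_two]; simp only [mul_add, mul_one]
      have := congrArg Matrix.trace this
      rw [trace_add, trace_add, ti, t, trace_mul_comm g₂ g₁, trace_zero] at this
      rw [this, zero_mul]
  · obtain ⟨u₁, v₁, huv₁, hf₁⟩ := normal_form h3 hg₁ h₁ h₁' E1
    by_cases E2 : g₂ ^ 2 + g₂ + 1 = 0
    · have t := trace_one huv₁ hf₁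
      have : g₁ * (g₂ * g₂) + g₁ * g₂ + g₁ = 0 := by
        rw [← mul_zero g₁, ← E2, pow_two]; simp only [mul_add, mul_one]
      have := congrArg Matrix.trace this
      rw [trace_add, trace_add, t, trace_zero] at this
      rw [this, zero_mul]
    · obtain ⟨u₂, v₂, huv₂, hf₂⟩ := normal_form h3 hg₂ h₂ h₂' E2
      rw [case_a hirr huv₁ huv₂ hf₁ hf₂, mul_zero]
end

section
/- Let p be a prime and c a positive integer. There are only finitely many positive integers r such that the group Sp₄(p^r) admits generators g₁, g₂ with g₁³ = g₂³ = 1 and (g₁g₂)^c = 1. That is, only finitely many groups Sp₄(p^r) are (3,3,c)-generated. -/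
namespace SpTri

open Module

section Abstract

variable {K : Type*} [Field K] {V : Type*} [AddCommGroup V] [Module K V]

/-- `f` is a semisimple element of order three fixing a hyperbolic plane pointwise; `e₁`, `e₂` is a
hyperbolic pair of eigenvectors for the other two eigenvalues. -/
def TypeI (w : K) (β : V →ₗ[K] V →ₗ[K] K) (f : V →ₗ[K] V) (e₁ e₂ : V) : Prop :=
  β e₁ e₂ = 1 ∧ ∀ x, f x = x + ((w - 1) * β x e₂) • e₁ - ((w ^ 2 - 1) * β x e₁) • e₂

/-- eigenvectors whose eigenvalues are not inverse to each other are orthogonal -/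
lemma orth {β : V →ₗ[K] V →ₗ[K] K} {f : V →ₗ[K] V} (hf : ∀ x y, β (f x) (f y) = β x y)
    {u v : V} {l m : K} (hu : f u = l • u) (hv : f v = m • v) (hlm : l * m ≠ 1) : β u v = 0 := by
  have h := hf u v
  rw [hu, hv] at h
  simp only [map_smul, LinearMap.smul_apply, smul_eq_mul] at h
  have : (l * m - 1) * β u v = 0 := by linear_combination h
  rcases mul_eq_zero.1 this with h | h
  · exact absurd (sub_eq_zero.1 h) hlm
  · exact h

/-- every eigenvector has a dual eigenvector -/
lemma dual_eig {β : V →ₗ[K] V →ₗ[K] K} (hnd : ∀ x, x ≠ 0 → ∃ y, β x y ≠ 0)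
    {f : V →ₗ[K] V} (hf : ∀ x y, β (f x) (f y) = β x y) (hf3 : ∀ x, f (f (f x)) = x)
    (h3 : (3 : K) ≠ 0) {z : K} (hz : z ^ 3 = 1) {e : V} (he : e ≠ 0) (hfe : f e = z • e) :
    ∃ e', f e' = z ^ 2 • e' ∧ β e e' = 1 := by
  obtain ⟨y, hy⟩ := hnd e he
  have h1 : ∀ x, z * β e (f x) = β e x := by
    intro x
    rw [← hf e x, hfe]; simp
  have h2 : ∀ x, β e (f x) = z ^ 2 * β e x := by
    intro x
    rw [← h1 x]; linear_combination (-β e (f x)) * hz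
  refine ⟨(3 * β e y)⁻¹ • (y + z • f y + z ^ 2 • f (f y)), ?_, ?_⟩
  · simp only [map_smul, map_add, hf3]
    rw [smul_comm]
    congr 1
    have : y = (z ^ 3) • y := by rw [hz, one_smul]
    have h4 : z ^ 4 = z := by linear_combination z * hz
    simp only [smul_add, smul_smul]
    ring_nf
    rw [hz, h4, one_smul]; abel
  · simp only [map_smul, map_add, h2, smul_eq_mul]
    have : β e y + z * (z ^ 2 * β e y) + z ^ 2 * (z ^ 2 * (z ^ 2 * β e y)) = 3 * β e y := by
      linear_combination (β e y + β e y * (z ^ 3 + 1)) * hz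
    rw [this]
    exact inv_mul_cancel₀ (mul_ne_zero h3 hy)

/-- expansion with respect to a symplectic basis -/
lemma expand (hV : finrank K V = 4) {β : V →ₗ[K] V →ₗ[K] K} (halt : ∀ x, β x x = 0)
    (hskew : ∀ x y, β x y = - β y x)
    {e₁ e₂ u v : V} (he : β e₁ e₂ = 1) (huv : β u v = 1)
    (h1 : β e₁ u = 0) (h2 : β e₁ v = 0) (h3 : β e₂ u = 0) (h4 : β e₂ v = 0) (x : V) :
    x = β x e₂ • e₁ - β x e₁ • e₂ + β x v • u - β x u • v := by
  have he' : β e₂ e₁ = -1 := by rw [hskew, he]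
  have huv' : β v u = -1 := by rw [hskew, huv]
  have h1' : β u e₁ = 0 := by rw [hskew, h1, neg_zero]
  have h2' : β v e₁ = 0 := by rw [hskew, h2, neg_zero]
  have h3' : β u e₂ = 0 := by rw [hskew, h3, neg_zero]
  have h4' : β v e₂ = 0 := by rw [hskew, h4, neg_zero]
  have hli : LinearIndependent K ![e₁, e₂, u, v] := by
    rw [Fintype.linearIndependent_iff]
    intro g hg
    simp only [Fin.sum_univ_four] at hg
    have hb : ∀ y, g 0 * β e₁ y + g 1 * β e₂ y + g 2 * β u y + g 3 * β v y = 0 := by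
      intro y
      have := congrArg (fun t => β t y) hg
      simpa using this
    have b1 := hb e₁
    have b2 := hb e₂
    have b3 := hb u
    have b4 := hb v
    simp only [he, huv, h1, h2, h3, h4, he', huv', h1', h2', h3', h4', halt] at b1 b2 b3 b4
    intro i
    fin_cases i <;> simp <;> grind
  let b := basisOfLinearIndependentOfCardEqFinrank hli (by simp [hV])
  have hx := b.sum_repr x
  simp only [Fin.sum_univ_four, b, coe_basisOfLinearIndependentOfCardEqFinrank] at hx
  simp only [Matrix.cons_val] at hx
  generalize ((basisOfLinearIndependentOfCardEqFinrank hli _).repr x) 0 = c0 at hx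
  generalize ((basisOfLinearIndependentOfCardEqFinrank hli _).repr x) 1 = c1 at hx
  generalize ((basisOfLinearIndependentOfCardEqFinrank hli _).repr x) 2 = c2 at hx
  generalize ((basisOfLinearIndependentOfCardEqFinrank hli _).repr x) 3 = c3 at hx
  rw [← hx]
  simp [he, huv, h1, h2, h3, h4, he', huv', h1', h2', h3', h4', halt]

lemma classify (hV : finrank K V = 4) {β : V →ₗ[K] V →ₗ[K] K} (halt : ∀ x, β x x = 0)
    (hskew : ∀ x y, β x y = - β y x) (hnd : ∀ x, x ≠ 0 → ∃ y, β x y ≠ 0)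
    {f : V →ₗ[K] V} (hf : ∀ x y, β (f x) (f y) = β x y) (hf3 : ∀ x, f (f (f x)) = x)
    (h3 : (3 : K) ≠ 0) {w : K} (hw : w ^ 2 + w + 1 = 0) :
    (∀ x, f x = x) ∨ (∀ x, f (f x) + f x + x = 0) ∨ ∃ e₁ e₂, TypeI w β f e₁ e₂ := by
  have hw3 : w ^ 3 = 1 := by linear_combination (w - 1) * hw
  have hw1 : w ≠ 1 := by rintro rfl; apply h3; linear_combination hw
  have hw2 : w ^ 2 ≠ 1 := by
    intro h; apply hw1; linear_combination hw3 - w * h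
  by_cases hu : ∀ x, f (f x) + f x + x = 0
  · exact Or.inr (Or.inl hu)
  push Not at hu
  obtain ⟨x0, hx0⟩ := hu
  set u := f (f x0) + f x0 + x0 with hudef
  have hfu : f u = (1 : K) • u := by
    simp only [hudef, map_add, hf3, one_smul]; abel
  obtain ⟨v, hfv, huv⟩ := dual_eig hnd hf hf3 h3 (one_pow 3) hx0 hfu
  have hex : (∀ x, f x = x) ∨ ∃ e₁ e₂, f e₁ = w • e₁ ∧ f e₂ = w ^ 2 • e₂ ∧ β e₁ e₂ = 1 := by
    by_cases ha : ∀ x, x + w ^ 2 • f x + w • f (f x) = 0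
    · by_cases hb : ∀ x, x + w • f x + w ^ 2 • f (f x) = 0
      · left
        intro x
        have e1 := ha x
        have e2 := hb x
        have key : (w ^ 2 - w) • (x - f x) = 0 := by
          have : (w ^ 2 - w) • (x - f x) = w ^ 2 • (x + w ^ 2 • f x + w • f (f x))
              - w • (x + w • f x + w ^ 2 • f (f x))
              + ((w ^ 3 - 1) * (-w)) • f x + (w ^ 2 + w + 1) • (0 : V)
               + (w - w^2 + w^2 - w) • f x := by
            module
          rw [this, e1, e2, hw3]; simp
        have : w ^ 2 - w ≠ 0 := by
          intro h
          have : w * (w - 1) = 0 := by linear_combination h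
          rcases mul_eq_zero.1 this with h | h
          · rw [h] at hw; simp at hw
          · exact hw1 (sub_eq_zero.1 h)
        exact (sub_eq_zero.1 ((smul_eq_zero.1 key).resolve_left this)).symm
      · right
        push Not at hb
        obtain ⟨x, hx⟩ := hb
        have hfx : f (x + w • f x + w ^ 2 • f (f x)) = w ^ 2 • (x + w • f x + w ^ 2 • f (f x)) := by
          simp only [map_add, map_smul, hf3, smul_add, smul_smul]
          have h4 : w ^ 2 * w ^ 2 = w := by linear_combination w * hw3
          have h5 : w ^ 2 * w = 1 := by linear_combination hw3
          rw [h4, h5, one_smul]; abel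
        obtain ⟨e', he', hb'⟩ := dual_eig hnd hf hf3 h3 (z := w ^ 2)
          (by linear_combination (w ^ 3 + 1) * hw3) hx hfx
        refine ⟨-e', _, ?_, hfx, ?_⟩
        · rw [map_neg, he']
          have h4 : (w ^ 2) ^ 2 = w := by linear_combination w * hw3
          rw [h4, smul_neg]
        · rw [hskew, map_neg, hb', neg_neg]
    · right
      push Not at ha
      obtain ⟨x, hx⟩ := ha
      have hfx : f (x + w ^ 2 • f x + w • f (f x)) = w • (x + w ^ 2 • f x + w • f (f x)) := by
        simp only [map_add, map_smul, hf3, smul_add, smul_smul]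
        have h4 : w * w ^ 2 = 1 := by linear_combination hw3
        rw [h4, one_smul, pow_two]; abel
      obtain ⟨e', he', hb'⟩ := dual_eig hnd hf hf3 h3 hw3 hx hfx
      exact ⟨_, e', hfx, he', hb'⟩
  rcases hex with h | ⟨e₁, e₂, hfe1, hfe2, he⟩
  · exact Or.inl h
  refine Or.inr (Or.inr ⟨e₁, e₂, he, fun x => ?_⟩)
  have hx := expand hV halt hskew he huv (orth hf hfe1 hfu (by simpa using hw1))
    (orth hf hfe1 hfv (by simpa using hw1)) (orth hf hfe2 hfu (by simpa using hw2))
    (orth hf hfe2 hfv (by simpa using hw2)) x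
  have hfx := congrArg f hx
  simp only [map_add, map_sub, map_smul, hfu, hfv, hfe1, hfe2] at hfx
  rw [hfx]
  conv_rhs => enter [1, 1]; rw [hx]
  module

lemma char3 (hV : finrank K V = 4) {β : V →ₗ[K] V →ₗ[K] K}
    (hskew : ∀ x y, β x y = - β y x) (hnd : ∀ x, x ≠ 0 → ∃ y, β x y ≠ 0)
    {f : V →ₗ[K] V} (hf : ∀ x y, β (f x) (f y) = β x y) (hf3 : ∀ x, f (f (f x)) = x)
    (h3 : (3 : K) = 0) (x : V) : f (f x) + f x + x = 0 := by
  have h2 : (2 : K) ≠ 0 := by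
    intro h; exact one_ne_zero (α := K) (by linear_combination h3 - h)
  have hsm : ∀ y : V, (3 : K) • y = 0 := by intro y; rw [h3, zero_smul]
  have hN : ∀ y, f (f y) + f y + y = f (f y) - (2 : K) • f y + y := by
    intro y
    have : f (f y) + f y + y = f (f y) - (2 : K) • f y + y + (3 : K) • f y := by module
    rw [this, hsm, add_zero]
  set N2 : V → V := fun y => f (f y) + f y + y with hN2
  have hfN2 : ∀ y, f (N2 y) = N2 y := by
    intro y; simp only [hN2, map_add, hf3]; abel
  have hsymm : ∀ y z, β (N2 y) z = β y (N2 z) := by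
    intro y z
    have a1 : β (f y) z = β y (f (f z)) := by rw [← hf (f y) z, ← hf (f (f y)), hf3]
    have a2 : β (f (f y)) z = β y (f z) := by rw [← hf _ z, hf3]
    simp only [hN2, map_add, LinearMap.add_apply, a1, a2]
    ring
  have hanti : ∀ y z, β (N2 y) z = - β (N2 z) y := fun y z => by rw [hsymm, hskew]
  have hdiag : ∀ y, β (N2 y) y = 0 := by
    intro y
    have := hanti y y
    have h' : 2 * β (N2 y) y = 0 := by linear_combination this
    exact (mul_eq_zero.1 h').resolve_left h2
  by_contra hne
  change N2 x ≠ 0 at hne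
  obtain ⟨y, hy⟩ := hnd _ hne
  have hli : LinearIndependent K ![x, y, f x - x, N2 x, N2 y] := by
    rw [Fintype.linearIndependent_iff]
    intro g hg
    simp only [Fin.sum_univ_five, Matrix.cons_val] at hg
    have hN2' : ∀ y, N2 y = f (f y) + f y + y := fun _ => rfl
    have hN2N2 : ∀ y, N2 (N2 y) = 0 := by
      intro y; rw [hN2', hfN2, hfN2]
      have : N2 y + N2 y + N2 y = (3 : K) • N2 y := by module
      rw [this, hsm]
    have hN2f : ∀ y, N2 (f y) = N2 y := by
      intro y; simp only [hN2, hf3]; abel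
    have k1 : g 0 • N2 x + g 1 • N2 y = 0 := by
      have t : N2 (g 0 • x + g 1 • y + g 2 • (f x - x) + g 3 • N2 x + g 4 • N2 y)
        = g 0 • N2 x + g 1 • N2 y + g 2 • (N2 (f x) - N2 x) + g 3 • N2 (N2 x) + g 4 • N2 (N2 y) := by
        simp only [hN2', map_add, map_smul, map_sub]
        module
      rw [hg, hN2f, hN2N2, hN2N2] at t
      simp only [hN2, map_zero, add_zero, sub_self, smul_zero] at t
      exact t.symm
    have g0 : g 0 = 0 := by
      have := congrArg (fun t => β t y) k1
      simp [hdiag] at this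
      exact this.resolve_right hy
    have hy' : β (N2 y) x ≠ 0 := by rw [hanti]; simpa using hy
    have g1 : g 1 = 0 := by
      have := congrArg (fun t => β t x) k1
      simp [hdiag] at this
      exact this.resolve_right hy'
    rw [g0, g1] at hg
    simp only [zero_smul, zero_add] at hg
    have k2 : g 2 • N2 x = 0 := by
      have t := congrArg (fun t => f t - t) hg
      simp only [map_add, map_smul, map_sub, hfN2, map_zero, sub_zero] at t
      rw [← t, hN2', hN x]; module
    have g2 : g 2 = 0 := (smul_eq_zero.1 k2).resolve_right hne
    rw [g2] at hg
    simp only [zero_smul, zero_add] at hg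
    have g3 : g 3 = 0 := by
      have := congrArg (fun t => β t y) hg
      simp [hdiag] at this
      exact this.resolve_right hy
    have g4 : g 4 = 0 := by
      have := congrArg (fun t => β t x) hg
      simp [hdiag] at this
      exact this.resolve_right hy'
    intro i
    fin_cases i <;> assumption
  have : FiniteDimensional K V := FiniteDimensional.of_finrank_pos (by omega)
  have := hli.fintype_card_le_finrank
  simp [hV] at this

/-- joint irreducibility of two endomorphisms -/
def Irr (f g : V →ₗ[K] V) : Prop :=
  ∀ W : Submodule K V, (∀ x ∈ W, f x ∈ W) → (∀ x ∈ W, g x ∈ W) → W ≠ ⊥ → W = ⊤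

lemma not_irr_of_span_pair (hV : finrank K V = 4) {f g : V →ₗ[K] V} (h : Irr f g) (u v : V)
    (hu : u ≠ 0)
    (h1 : f u ∈ Submodule.span K {u, v}) (h2 : f v ∈ Submodule.span K {u, v})
    (h3 : g u ∈ Submodule.span K {u, v}) (h4 : g v ∈ Submodule.span K {u, v}) : False := by
  have key : ∀ k : V →ₗ[K] V, k u ∈ Submodule.span K {u, v} → k v ∈ Submodule.span K {u, v} →
      ∀ x ∈ Submodule.span K {u, v}, k x ∈ Submodule.span K {u, v} := by
    intro k hku hkv x hx
    obtain ⟨a, b, rfl⟩ := Submodule.mem_span_pair.1 hx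
    rw [map_add, map_smul, map_smul]
    exact add_mem (Submodule.smul_mem _ _ hku) (Submodule.smul_mem _ _ hkv)
  have ht := h _ (key f h1 h2) (key g h3 h4) (by
    intro hb
    have : u ∈ Submodule.span K {u, v} := Submodule.subset_span (by simp)
    rw [hb] at this
    exact hu (by simpa using this))
  classical
  have hc := finrank_span_finset_le_card (R := K) ({u, v} : Finset V)
  have hc2 : ({u, v} : Finset V).card ≤ 2 := Finset.card_le_two
  have : (({u, v} : Finset V) : Set V) = {u, v} := by simp
  rw [Set.finrank, this, ht, finrank_top] at hc
  omega

lemma not_one [IsAlgClosed K] (hV : finrank K V = 4) {f g : V →ₗ[K] V} (h : Irr f g)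
    (hf : ∀ x, f x = x) : False := by
  have : FiniteDimensional K V := FiniteDimensional.of_finrank_pos (by omega)
  have : Nontrivial V := nontrivial_of_finrank_pos (R := K) (by omega)
  obtain ⟨l, hl⟩ := Module.End.exists_eigenvalue g
  obtain ⟨v, hv⟩ := hl.exists_hasEigenvector
  have hvm : v ∈ Submodule.span K {v, v} := Submodule.subset_span (by simp)
  have hg : g v ∈ Submodule.span K {v, v} := by
    rw [hv.apply_eq_smul]; exact Submodule.smul_mem _ _ hvm
  exact not_irr_of_span_pair hV h v v hv.2 (by rw [hf]; exact hvm) (by rw [hf]; exact hvm) hg hg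

lemma irr_symm {f g : V →ₗ[K] V} (h : Irr f g) : Irr g f :=
  fun W h1 h2 h3 => h W h2 h1 h3

lemma not_quad [IsAlgClosed K] (hV : finrank K V = 4) {f g : V →ₗ[K] V} (h : Irr f g)
    (hf : ∀ x, f (f x) + f x + x = 0) (hg : ∀ x, g (g x) + g x + x = 0) : False := by
  have : FiniteDimensional K V := FiniteDimensional.of_finrank_pos (by omega)
  have : Nontrivial V := nontrivial_of_finrank_pos (R := K) (by omega)
  obtain ⟨l, hl⟩ := Module.End.exists_eigenvalue (f * g : Module.End K V)
  obtain ⟨v, hv⟩ := hl.exists_hasEigenvector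
  have hfg : f (g v) = l • v := hv.apply_eq_smul
  have hl0 : l ≠ 0 := by
    rintro rfl
    rw [zero_smul] at hfg
    have h1 := hf (g v)
    rw [hfg] at h1
    simp at h1
    have h2 := hg v
    rw [h1] at h2
    simp at h2
    exact hv.2 h2
  have hvm : v ∈ Submodule.span K {v, g v} := Submodule.subset_span (by simp)
  have hgm : g v ∈ Submodule.span K {v, g v} := Submodule.subset_span (by simp)
  refine not_irr_of_span_pair hV h v (g v) hv.2 ?_ ?_ hgm ?_
  · have h1 := hf (g v)
    rw [hfg, map_smul] at h1
    have : f v = l⁻¹ • (l • f v) := by rw [smul_smul, inv_mul_cancel₀ hl0, one_smul]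
    rw [this]
    have : l • f v = - (l • v) - g v := by
      rw [eq_sub_iff_add_eq, eq_neg_iff_add_eq_zero]
      rw [← h1]; abel
    rw [this]
    exact Submodule.smul_mem _ _ (sub_mem (neg_mem (Submodule.smul_mem _ _ hvm)) hgm)
  · rw [hfg]; exact Submodule.smul_mem _ _ hvm
  · have : g (g v) = - v - g v := by
      rw [eq_sub_iff_add_eq, eq_neg_iff_add_eq_zero]; exact hg v
    rw [this]
    exact sub_mem (neg_mem hvm) hgm

/-- normal forms of pairs under scaling by `(u, u⁻¹)` -/
def Nrm (S : Set K) : Set (K × K) := {1} ×ˢ S ∪ {(0, 1), (0, 0)}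

lemma nrm_finite {S : Set K} (hS : S.Finite) : (Nrm S).Finite :=
  ((Set.finite_singleton _).prod hS).union (by simp)

lemma exists_nrm {S : Set K} (x y : K) (h : x * y ∈ S) :
    ∃ u : K, u ≠ 0 ∧ (u * x, u⁻¹ * y) ∈ Nrm S := by
  by_cases hx : x = 0
  · by_cases hy : y = 0
    · exact ⟨1, one_ne_zero, by simp [hx, hy, Nrm]⟩
    · exact ⟨y, hy, by simp [hx, hy, Nrm]⟩
  · exact ⟨x⁻¹, inv_ne_zero hx, by simp [hx, h, Nrm]⟩

lemma TypeI.scale {w : K} {β : V →ₗ[K] V →ₗ[K] K} {f : V →ₗ[K] V} {e₁ e₂ : V}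
    (h : TypeI w β f e₁ e₂) {s : K} (hs : s ≠ 0) : TypeI w β f (s • e₁) (s⁻¹ • e₂) := by
  refine ⟨by simp [h.1, hs], fun x => ?_⟩
  rw [h.2 x]
  simp only [map_smul, smul_eq_mul, smul_smul]
  have h1 : (w - 1) * (s⁻¹ * β x e₂) * s = (w - 1) * β x e₂ := by field_simp
  have h2 : (w ^ 2 - 1) * (s * β x e₁) * s⁻¹ = (w ^ 2 - 1) * β x e₁ := by field_simp
  rw [h1, h2]

/-- the set of traces of fourdimensional matrices of order dividing `c` -/
def Tc (K : Type*) [Field K] (c : ℕ) : Set K :=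
  {t | ∃ M : Matrix (Fin 4) (Fin 4) K, M ^ c = 1 ∧ t = M.trace}

/-- the set of values at one of characteristic polynomials of matrices of order dividing `c` -/
def Dc (K : Type*) [Field K] (c : ℕ) : Set K :=
  {t | ∃ M : Matrix (Fin 4) (Fin 4) K, M ^ c = 1 ∧ t = (M - 1).det}

def MA (w x11 x22 x12 x21 : K) : Matrix (Fin 4) (Fin 4) K :=
  !![w, 0, -((w - 1) * x21), -((w - 1) * x22);
     0, w ^ 2, (w ^ 2 - 1) * x11, (w ^ 2 - 1) * x12;
     0, 0, 1, 0;
     0, 0, 0, 1]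

def MB (w x11 x22 x12 x21 : K) : Matrix (Fin 4) (Fin 4) K :=
  !![1, 0, 0, 0;
     0, 1, 0, 0;
     (w - 1) * x12, (w - 1) * x22, w, 0;
     -((w ^ 2 - 1) * x11), -((w ^ 2 - 1) * x21), 0, w ^ 2]

def MA2 (w x y z : K) : Matrix (Fin 4) (Fin 4) K :=
  !![w, 0, (w - 1) * (z - 1), (w - 1) * y;
     0, w ^ 2, -((w ^ 2 - 1) * x), -((w ^ 2 - 1) * z);
     0, 0, 1, 0;
     0, 0, 0, 1]

def MB2 (K : Type*) [Field K] : Matrix (Fin 4) (Fin 4) K :=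
  !![0, 0, -1, 0;
     0, 0, 0, -1;
     1, 0, -1, 0;
     0, 1, 0, -1]

lemma trace1 {w : K} (hw : w ^ 2 + w + 1 = 0) (x11 x22 x12 x21 : K) :
    (MA w x11 x22 x12 x21 * MB w x11 x22 x12 x21).trace
      = -2 + 6 * (x11 * x22) - 3 * (x12 * x21) := by
  have hw2 : w ^ 2 = - w - 1 := by linear_combination hw
  simp only [MA, MB, Matrix.trace, Matrix.diag, Matrix.mul_apply, Fin.sum_univ_four]
  simp
  rw [hw2]
  ring_nf
  rw [hw2]
  ring

lemma det1 {w : K} (hw : w ^ 2 + w + 1 = 0) (x11 x22 x12 x21 : K) :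
    (MA w x11 x22 x12 x21 * MB w x11 x22 x12 x21 - 1).det
      = (3 * (1 - x11 * x22 + x12 * x21)) ^ 2 := by
  have hw2 : w ^ 2 = - w - 1 := by linear_combination hw
  have hfac : MA w x11 x22 x12 x21 * MB w x11 x22 x12 x21 - 1 =
    !![w - 1 - (w - 1) ^ 2 * x12 * x21 + (w - 1) * (w ^ 2 - 1) * x22 * x11,
        -((w - 1) ^ 2) * x21 * x22 + (w - 1) * (w ^ 2 - 1) * x22 * x21,
        -((w - 1) * x21 * w), -((w - 1) * x22 * w ^ 2);
       (w ^ 2 - 1) * x11 * (w - 1) * x12 - (w ^ 2 - 1) ^ 2 * x12 * x11,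
        w ^ 2 - 1 + (w ^ 2 - 1) * x11 * (w - 1) * x22 - (w ^ 2 - 1) ^ 2 * x12 * x21,
        (w ^ 2 - 1) * x11 * w, (w ^ 2 - 1) * x12 * w ^ 2;
       (w - 1) * x12, (w - 1) * x22, w - 1, 0;
       -((w ^ 2 - 1) * x11), -((w ^ 2 - 1) * x21), 0, w ^ 2 - 1] := by
    ext i j
    fin_cases i <;> fin_cases j <;>
      simp [MA, MB] <;> ring
  rw [hfac]
  rw [Matrix.det_succ_row_zero]
  simp [Fin.sum_univ_succ, Matrix.det_fin_three, Fin.succAbove, Matrix.submatrix]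
  grind

lemma trace2 {w : K} (x y z : K) :
    (MA2 w x y z * MB2 K).trace = -2 - (w - 1) + (w - w ^ 2) * z := by
  simp only [MA2, MB2, Matrix.trace, Matrix.diag, Matrix.mul_apply, Fin.sum_univ_four]
  simp
  ring

lemma det2 {w : K} (hw : w ^ 2 + w + 1 = 0) (x y z : K) :
    (MA2 w x y z * MB2 K - 1).det
      = (3 + (w - 1) - (w - 1) * (z - 1)) * (3 + (w ^ 2 - 1) + (w ^ 2 - 1) * z) + 3 * (x * y) := by
  have hw2 : w ^ 2 = - w - 1 := by linear_combination hw
  have hfac : MA2 w x y z * MB2 K - 1 =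
    !![(w - 1) * (z - 1) - 1, (w - 1) * y, -w - (w - 1) * (z - 1), - (w - 1) * y;
       -((w ^ 2 - 1) * x), -((w ^ 2 - 1) * z) - 1, (w ^ 2 - 1) * x, - w ^ 2 + (w ^ 2 - 1) * z;
       1, 0, -2, 0;
       0, 1, 0, -2] := by
    ext i j
    fin_cases i <;> fin_cases j <;>
      simp [MA2, MB2] <;> ring
  rw [hfac]
  rw [Matrix.det_succ_row_zero]
  simp [Fin.sum_univ_succ, Matrix.det_fin_three, Fin.succAbove, Matrix.submatrix]
  grind

def R1 (K : Type*) [Field K] (c : ℕ) : Set (K × K) :=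
  {q | -2 + 6 * q.1 - 3 * q.2 ∈ Tc K c ∧ (3 * (1 - q.1 + q.2)) ^ 2 ∈ Dc K c}

def R2 (w : K) (c : ℕ) : Set (K × K) :=
  {q | -2 - (w - 1) + (w - w ^ 2) * q.1 ∈ Tc K c ∧
    (3 + (w - 1) - (w - 1) * (q.1 - 1)) * (3 + (w ^ 2 - 1) + (w ^ 2 - 1) * q.1) + 3 * q.2 ∈ Dc K c}

def S1 (w : K) (c : ℕ) : Set (Matrix (Fin 4) (Fin 4) K × Matrix (Fin 4) (Fin 4) K) :=
  (fun t : (K × K) × (K × K) => (MA w t.1.1 t.1.2 t.2.1 t.2.2, MB w t.1.1 t.1.2 t.2.1 t.2.2)) ''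
    (Nrm (Prod.fst '' R1 K c) ×ˢ Nrm (Prod.snd '' R1 K c))

def S2 (w : K) (c : ℕ) : Set (Matrix (Fin 4) (Fin 4) K × Matrix (Fin 4) (Fin 4) K) :=
  (fun t : (K × K) × K => (MA2 w t.1.1 t.1.2 t.2, MB2 K)) ''
    (Nrm (Prod.snd '' R2 w c) ×ˢ (Prod.fst '' R2 w c))

lemma charpoly_finite [IsAlgClosed K] (c : ℕ) (hc : 0 < c) :
    (Matrix.charpoly '' {M : Matrix (Fin 4) (Fin 4) K | M ^ c = 1}).Finite := by
  classical
  set s := (Polynomial.nthRoots c (1 : K)).toFinset with hs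
  have hfin : ((fun m : Multiset K => (m.map (fun a => Polynomial.X - Polynomial.C a)).prod) ''
      (Set.Iic (4 • s.val))).Finite := (Set.finite_Iic _).image _
  refine hfin.subset ?_
  rintro _ ⟨M, hM, rfl⟩
  refine ⟨M.charpoly.roots, ?_, ?_⟩
  · rw [Set.mem_Iic, Multiset.le_iff_count]
    intro a
    by_cases ha : a ∈ M.charpoly.roots
    · have has : a ∈ s := by
        rw [hs, Multiset.mem_toFinset, Polynomial.mem_nthRoots hc]
        have hev : Module.End.HasEigenvalue (Matrix.toLin' M) a := by
          rw [Module.End.hasEigenvalue_iff_isRoot_charpoly, Matrix.charpoly_toLin']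
          exact Polynomial.isRoot_of_mem_roots ha
        obtain ⟨v, hv⟩ := hev.exists_hasEigenvector
        have hp := hv.pow_apply c
        have hM' : M ^ c = 1 := hM
        rw [← Matrix.toLin'_pow, hM'] at hp
        simp only [Matrix.toLin'_one, LinearMap.id_apply] at hp
        have : (a ^ c - 1) • v = 0 := by rw [sub_smul, ← hp, one_smul, sub_self]
        exact sub_eq_zero.1 ((smul_eq_zero.1 this).resolve_right hv.2)
      rw [Multiset.count_nsmul, Multiset.count_eq_one_of_mem s.nodup has]
      calc _ ≤ M.charpoly.roots.card := Multiset.count_le_card _ _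
        _ ≤ M.charpoly.natDegree := Polynomial.card_roots' _
        _ = 4 := by simp
        _ ≤ _ := by simp
    · rw [Multiset.count_eq_zero_of_notMem ha]; exact Nat.zero_le _
  · exact ((IsAlgClosed.splits M.charpoly).eq_prod_roots_of_monic M.charpoly_monic).symm

lemma tc_finite [IsAlgClosed K] (c : ℕ) (hc : 0 < c) : (Tc K c).Finite := by
  refine ((charpoly_finite (K := K) c hc).image (fun q => - q.coeff 3)).subset ?_
  rintro _ ⟨M, hM, rfl⟩
  refine ⟨M.charpoly, ⟨M, hM, rfl⟩, ?_⟩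
  rw [Matrix.trace_eq_neg_charpoly_coeff]; simp

lemma dc_finite [IsAlgClosed K] (c : ℕ) (hc : 0 < c) : (Dc K c).Finite := by
  refine ((charpoly_finite (K := K) c hc).image (fun q => q.eval 1)).subset ?_
  rintro _ ⟨M, hM, rfl⟩
  refine ⟨M.charpoly, ⟨M, hM, rfl⟩, ?_⟩
  simp only [Matrix.eval_charpoly]
  rw [map_one, ← neg_sub, Matrix.det_neg, Fintype.card_fin]
  ring

lemma r1_finite [IsAlgClosed K] (h3 : (3 : K) ≠ 0) (c : ℕ) (hc : 0 < c) : (R1 K c).Finite := by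
  have hsq : {s : K | s ^ 2 ∈ Dc K c}.Finite := by
    refine Set.Finite.preimage' (dc_finite c hc) (fun d _ => ?_)
    classical
    refine (Polynomial.nthRoots 2 d).toFinset.finite_toSet.subset ?_
    intro s hs
    simpa [Polynomial.mem_nthRoots] using hs
  refine Set.Finite.subset (Set.Finite.preimage (f := fun q : K × K =>
    (-2 + 6 * q.1 - 3 * q.2, 3 * (1 - q.1 + q.2))) ?_ ((tc_finite c hc).prod hsq)) ?_
  · rintro ⟨a, b⟩ - ⟨a', b'⟩ - h
    simp only [Prod.mk.injEq] at h ⊢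
    have h1 : 3 * (a - a') = 0 := by linear_combination h.1 + h.2
    have h1' := sub_eq_zero.1 ((mul_eq_zero.1 h1).resolve_left h3)
    have h2 : 3 * (b - b') = 0 := by linear_combination h.1 + 2 * h.2
    exact ⟨h1', sub_eq_zero.1 ((mul_eq_zero.1 h2).resolve_left h3)⟩
  · rintro ⟨a, b⟩ ⟨h1, h2⟩
    exact ⟨h1, h2⟩

lemma r2_finite [IsAlgClosed K] (h3 : (3 : K) ≠ 0) {w : K} (hw : w ^ 2 + w + 1 = 0)
    (c : ℕ) (hc : 0 < c) : (R2 w c).Finite := by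
  have hww : w - w ^ 2 ≠ 0 := by
    intro h
    apply h3
    grind
  refine Set.Finite.subset (Set.Finite.preimage (f := fun q : K × K =>
    (-2 - (w - 1) + (w - w ^ 2) * q.1,
      (3 + (w - 1) - (w - 1) * (q.1 - 1)) * (3 + (w ^ 2 - 1) + (w ^ 2 - 1) * q.1) + 3 * q.2)) ?_
      ((tc_finite c hc).prod (dc_finite c hc))) ?_
  · rintro ⟨a, b⟩ - ⟨a', b'⟩ - h
    simp only [Prod.mk.injEq] at h ⊢
    have h1 : (w - w ^ 2) * (a - a') = 0 := by linear_combination h.1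
    have h1' := sub_eq_zero.1 ((mul_eq_zero.1 h1).resolve_left hww)
    subst h1'
    have h2 : 3 * (b - b') = 0 := by linear_combination h.2
    exact ⟨rfl, sub_eq_zero.1 ((mul_eq_zero.1 h2).resolve_left h3)⟩
  · rintro ⟨a, b⟩ ⟨h1, h2⟩
    exact ⟨h1, h2⟩

lemma s1_finite [IsAlgClosed K] (h3 : (3 : K) ≠ 0) (w : K) (c : ℕ) (hc : 0 < c) :
    (S1 w c).Finite :=
  ((nrm_finite ((r1_finite h3 c hc).image _)).prod (nrm_finite ((r1_finite h3 c hc).image _))).image _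

lemma s2_finite [IsAlgClosed K] (h3 : (3 : K) ≠ 0) {w : K} (hw : w ^ 2 + w + 1 = 0)
    (c : ℕ) (hc : 0 < c) : (S2 w c).Finite :=
  ((nrm_finite ((r2_finite h3 hw c hc).image _)).prod ((r2_finite h3 hw c hc).image _)).image _

/-- four spanning vectors on which `f`, `g` act by given matrices -/
lemma matrices_of_span (hV : finrank K V = 4) {f g : V →ₗ[K] V} (v : Fin 4 → V)
    (hv : Submodule.span K (Set.range v) = ⊤) (A B : Matrix (Fin 4) (Fin 4) K)
    (hA : ∀ j, f (v j) = ∑ i, A i j • v i) (hB : ∀ j, g (v j) = ∑ i, B i j • v i) :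
    ∃ b : Basis (Fin 4) K V, (∀ i, b i = v i) ∧ LinearMap.toMatrix b b f = A ∧
      LinearMap.toMatrix b b g = B := by
  let b := basisOfTopLeSpanOfCardEqFinrank v hv.ge (by simp [hV])
  have hb : ∀ i, b i = v i := fun i => by simp [b]
  refine ⟨b, hb, ?_, ?_⟩
  · rw [← LinearMap.toMatrix_toLin b b A]
    congr 1
    apply b.ext
    intro j
    rw [Matrix.toLin_self, hb, hA]
    simp [hb]
  · rw [← LinearMap.toMatrix_toLin b b B]
    congr 1
    apply b.ext
    intro j
    rw [Matrix.toLin_self, hb, hB]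
    simp [hb]

lemma span_inv {f : V →ₗ[K] V} (v : Fin 4 → V)
    (h : ∀ j, f (v j) ∈ Submodule.span K (Set.range v)) :
    ∀ x ∈ Submodule.span K (Set.range v), f x ∈ Submodule.span K (Set.range v) := by
  intro x hx
  induction hx using Submodule.span_induction with
  | mem x hx => obtain ⟨j, rfl⟩ := hx; exact h j
  | zero => simp
  | add x y _ _ hx hy => rw [map_add]; exact add_mem hx hy
  | smul a x _ hx => rw [map_smul]; exact Submodule.smul_mem _ _ hx

lemma matrices_of_irr (hV : finrank K V = 4) {f g : V →ₗ[K] V} (h : Irr f g) (v : Fin 4 → V)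
    (hv : v 0 ≠ 0) (A B : Matrix (Fin 4) (Fin 4) K)
    (hA : ∀ j, f (v j) = ∑ i, A i j • v i) (hB : ∀ j, g (v j) = ∑ i, B i j • v i) :
    ∃ b : Basis (Fin 4) K V, LinearMap.toMatrix b b f = A ∧ LinearMap.toMatrix b b g = B := by
  have hmem : ∀ i, v i ∈ Submodule.span K (Set.range v) := fun i => Submodule.subset_span ⟨i, rfl⟩
  obtain ⟨b, -, h1, h2⟩ := matrices_of_span hV v (h _
    (span_inv v fun j => by
      rw [hA]; exact Submodule.sum_mem _ fun i _ => Submodule.smul_mem _ _ (hmem i))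
    (span_inv v fun j => by
      rw [hB]; exact Submodule.sum_mem _ fun i _ => Submodule.smul_mem _ _ (hmem i))
    (by intro hb; have := hmem 0; rw [hb] at this; exact hv (by simpa using this))) A B hA hB
  exact ⟨b, h1, h2⟩

lemma prod_pow {f g : V →ₗ[K] V} {c : ℕ} (hc : ((f * g : Module.End K V)) ^ c = 1)
    (b : Basis (Fin 4) K V) :
    (LinearMap.toMatrix b b f * LinearMap.toMatrix b b g) ^ c = 1 := by
  rw [← LinearMap.toMatrix_mul]
  have h := congrArg (LinearMap.toMatrixAlgEquiv b) hc
  rw [map_pow, map_one] at h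
  exact h

lemma mats1 (hV : finrank K V = 4) {β : V →ₗ[K] V →ₗ[K] K} (halt : ∀ x, β x x = 0)
    (hskew : ∀ x y, β x y = - β y x) {f g : V →ₗ[K] V} (h : Irr f g) {w : K} {e₁ e₂ f₁ f₂ : V}
    (hf : TypeI w β f e₁ e₂) (hg : TypeI w β g f₁ f₂) :
    ∃ b : Basis (Fin 4) K V,
      LinearMap.toMatrix b b f = MA w (β e₁ f₁) (β e₂ f₂) (β e₁ f₂) (β e₂ f₁) ∧
      LinearMap.toMatrix b b g = MB w (β e₁ f₁) (β e₂ f₂) (β e₁ f₂) (β e₂ f₁) := by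
  have he' : β e₂ e₁ = -1 := by rw [hskew, hf.1]
  have hf' : β f₂ f₁ = -1 := by rw [hskew, hg.1]
  refine matrices_of_irr hV h ![e₁, e₂, f₁, f₂] ?_ _ _ ?_ ?_
  · intro h0
    have h0 : e₁ = 0 := h0
    have := hf.1
    rw [h0] at this
    simp at this
  · intro j
    fin_cases j <;> simp [Fin.sum_univ_four, MA, hf.2, hf.1, he', halt, hskew f₁, hskew f₂] <;>
      module
  · intro j
    fin_cases j <;> simp [Fin.sum_univ_four, MB, hg.2, hg.1, hf', halt] <;>
      module

lemma case1 [IsAlgClosed K] (hV : finrank K V = 4) {β : V →ₗ[K] V →ₗ[K] K}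
    (halt : ∀ x, β x x = 0) (hskew : ∀ x y, β x y = - β y x) {f g : V →ₗ[K] V} (h : Irr f g)
    {c : ℕ} (hc : ((f * g : Module.End K V)) ^ c = 1)
    {w : K} (hw : w ^ 2 + w + 1 = 0) {e₁ e₂ f₁ f₂ : V}
    (hf : TypeI w β f e₁ e₂) (hg : TypeI w β g f₁ f₂) :
    ∃ b : Basis (Fin 4) K V, (LinearMap.toMatrix b b f, LinearMap.toMatrix b b g) ∈ S1 w c := by
  have hR : (β e₁ f₁ * β e₂ f₂, β e₁ f₂ * β e₂ f₁) ∈ R1 K c := by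
    obtain ⟨b, hb1, hb2⟩ := mats1 hV halt hskew h hf hg
    have hp := prod_pow hc b
    rw [hb1, hb2] at hp
    exact ⟨⟨_, hp, (trace1 hw _ _ _ _).symm⟩, ⟨_, hp, (det1 hw _ _ _ _).symm⟩⟩
  obtain ⟨u, hu, hu'⟩ := exists_nrm (S := Prod.fst '' R1 K c) _ _ ⟨_, hR, rfl⟩
  obtain ⟨v, hv, hv'⟩ := exists_nrm (S := Prod.snd '' R1 K c) _ _ ⟨_, hR, rfl⟩
  obtain ⟨s, hs⟩ := IsAlgClosed.exists_pow_nat_eq (u * v) (n := 2) (by norm_num)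
  have hs0 : s ≠ 0 := by
    rintro rfl
    exact mul_ne_zero hu hv (by simpa using hs.symm)
  obtain ⟨b, hb1, hb2⟩ := mats1 hV halt hskew h (hf.scale hs0) (hg.scale (s := s / v)
    (div_ne_zero hs0 hv))
  refine ⟨b, ((_, _), (_, _)), ⟨hu', hv'⟩, ?_⟩
  rw [hb1, hb2]
  have k1 : β (s • e₁) ((s / v) • f₁) = u * β e₁ f₁ := by
    simp only [map_smul, LinearMap.smul_apply, smul_eq_mul]
    field_simp
    rw [hs]; ring
  have k2 : β (s⁻¹ • e₂) ((s / v)⁻¹ • f₂) = u⁻¹ * β e₂ f₂ := by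
    simp only [map_smul, LinearMap.smul_apply, smul_eq_mul]
    field_simp
    rw [hs]; ring
  have k3 : β (s • e₁) ((s / v)⁻¹ • f₂) = v * β e₁ f₂ := by
    simp only [map_smul, LinearMap.smul_apply, smul_eq_mul]
    field_simp
  have k4 : β (s⁻¹ • e₂) ((s / v) • f₁) = v⁻¹ * β e₂ f₁ := by
    simp only [map_smul, LinearMap.smul_apply, smul_eq_mul]
    field_simp
  rw [k1, k2, k3, k4]

lemma mats2 (hV : finrank K V = 4) {β : V →ₗ[K] V →ₗ[K] K} (halt : ∀ x, β x x = 0)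
    (hskew : ∀ x y, β x y = - β y x) {f g : V →ₗ[K] V} (h : Irr f g) {w : K} {e₁ e₂ : V}
    (hf : TypeI w β f e₁ e₂) (hgβ : ∀ x y, β (g x) (g y) = β x y)
    (hg : ∀ x, g (g x) + g x + x = 0) :
    ∃ b : Basis (Fin 4) K V,
      LinearMap.toMatrix b b f = MA2 w (β (g e₁) e₁) (β (g e₂) e₂) (β (g e₂) e₁) ∧
      LinearMap.toMatrix b b g = MB2 K := by
  have he' : β e₂ e₁ = -1 := by rw [hskew, hf.1]
  have hgg : ∀ x, g (g x) = - x - g x := by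
    intro x
    rw [eq_sub_iff_add_eq, eq_neg_iff_add_eq_zero]; exact hg x
  have hz : β (g e₁) e₂ = β (g e₂) e₁ - 1 := by
    rw [← hgβ (g e₁) e₂, hgg]
    simp only [map_sub, map_neg, LinearMap.sub_apply, LinearMap.neg_apply, hgβ, hf.1]
    rw [hskew e₁]; ring
  refine matrices_of_irr hV h ![e₁, e₂, g e₁, g e₂] ?_ _ _ ?_ ?_
  · intro h0
    have h0 : e₁ = 0 := h0
    have := hf.1
    rw [h0] at this
    simp at this
  · intro j
    fin_cases j <;> simp [Fin.sum_univ_four, MA2, hf.2, hf.1, he', halt, hz] <;>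
      module
  · intro j
    fin_cases j <;> simp [Fin.sum_univ_four, MB2, hgg] <;>
      module

lemma case2 [IsAlgClosed K] (hV : finrank K V = 4) {β : V →ₗ[K] V →ₗ[K] K}
    (halt : ∀ x, β x x = 0) (hskew : ∀ x y, β x y = - β y x) {f g : V →ₗ[K] V} (h : Irr f g)
    {c : ℕ} (hc : ((f * g : Module.End K V)) ^ c = 1)
    {w : K} (hw : w ^ 2 + w + 1 = 0) {e₁ e₂ : V}
    (hf : TypeI w β f e₁ e₂) (hgβ : ∀ x y, β (g x) (g y) = β x y)
    (hg : ∀ x, g (g x) + g x + x = 0) :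
    ∃ b : Basis (Fin 4) K V, (LinearMap.toMatrix b b f, LinearMap.toMatrix b b g) ∈ S2 w c := by
  have hR : (β (g e₂) e₁, β (g e₁) e₁ * β (g e₂) e₂) ∈ R2 w c := by
    obtain ⟨b, hb1, hb2⟩ := mats2 hV halt hskew h hf hgβ hg
    have hp := prod_pow hc b
    rw [hb1, hb2] at hp
    exact ⟨⟨_, hp, (trace2 _ _ _).symm⟩, ⟨_, hp, (det2 hw _ _ _).symm⟩⟩
  obtain ⟨u, hu, hu'⟩ := exists_nrm (S := Prod.snd '' R2 w c) _ _ ⟨_, hR, rfl⟩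
  obtain ⟨s, hs⟩ := IsAlgClosed.exists_pow_nat_eq u (n := 2) (by norm_num)
  have hs0 : s ≠ 0 := by
    rintro rfl
    exact hu (by simpa using hs.symm)
  obtain ⟨b, hb1, hb2⟩ := mats2 hV halt hskew h (hf.scale hs0) hgβ hg
  refine ⟨b, ((_, _), _), ⟨hu', ⟨_, hR, rfl⟩⟩, ?_⟩
  rw [hb1, hb2]
  have k1 : β (g (s • e₁)) (s • e₁) = u * β (g e₁) e₁ := by
    simp only [map_smul, LinearMap.smul_apply, smul_eq_mul]
    rw [← hs]; ring
  have k2 : β (g (s⁻¹ • e₂)) (s⁻¹ • e₂) = u⁻¹ * β (g e₂) e₂ := by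
    simp only [map_smul, LinearMap.smul_apply, smul_eq_mul]
    rw [← hs]; field_simp
  have k3 : β (g (s⁻¹ • e₂)) (s • e₁) = β (g e₂) e₁ := by
    simp only [map_smul, LinearMap.smul_apply, smul_eq_mul]
    field_simp
  rw [k1, k2, k3]

/-- Up to simultaneous conjugation there are finitely many irreducible pairs. -/
lemma finitely_many [IsAlgClosed K] (c : ℕ) (hc : 0 < c) :
    ∃ S : Set (Matrix (Fin 4) (Fin 4) K × Matrix (Fin 4) (Fin 4) K), S.Finite ∧
      ∀ (V : Type _) [AddCommGroup V] [Module K V], finrank K V = 4 →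
      ∀ β : V →ₗ[K] V →ₗ[K] K, (∀ x, β x x = 0) → (∀ x, x ≠ 0 → ∃ y, β x y ≠ 0) →
      ∀ f g : V →ₗ[K] V, (∀ x y, β (f x) (f y) = β x y) → (∀ x y, β (g x) (g y) = β x y) →
        f ^ 3 = (1 : Module.End K V) → g ^ 3 = (1 : Module.End K V) →
        (f * g) ^ c = (1 : Module.End K V) → Irr f g →
        ∃ b : Basis (Fin 4) K V, (LinearMap.toMatrix b b f, LinearMap.toMatrix b b g) ∈ S := by
  obtain ⟨w, hw⟩ : ∃ w : K, w ^ 2 + w + 1 = 0 := by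
    obtain ⟨w, hw⟩ := IsAlgClosed.exists_root
      (Polynomial.X ^ 2 + Polynomial.X + 1 : Polynomial K) (by
        have : (Polynomial.X ^ 2 + Polynomial.X + 1 : Polynomial K).degree = 2 := by
          compute_degree!
        rw [this]; decide)
    exact ⟨w, by simpa using hw⟩
  by_cases h3 : (3 : K) = 0
  · refine ⟨∅, Set.finite_empty, ?_⟩
    intro V _ _ hV β halt hnd f g hf hg hf3 hg3 hfg hirr
    have hskew : ∀ x y, β x y = - β y x := by
      intro x y
      have := halt (x + y)
      simp only [map_add, LinearMap.add_apply, halt] at this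
      linear_combination this
    exact (not_quad hV hirr
      (char3 hV hskew hnd hf (fun x => by simpa [pow_succ] using LinearMap.congr_fun hf3 x) h3)
      (char3 hV hskew hnd hg (fun x => by simpa [pow_succ] using LinearMap.congr_fun hg3 x) h3)).elim
  · refine ⟨S1 w c ∪ S2 w c ∪ Prod.swap '' S2 w c,
      ((s1_finite h3 w c hc).union (s2_finite h3 hw c hc)).union
        ((s2_finite h3 hw c hc).image _), ?_⟩
    intro V _ _ hV β halt hnd f g hf hg hf3 hg3 hfg hirr
    have hskew : ∀ x y, β x y = - β y x := by
      intro x y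
      have := halt (x + y)
      simp only [map_add, LinearMap.add_apply, halt] at this
      linear_combination this
    have hf3' : ∀ x, f (f (f x)) = x :=
      fun x => by simpa [pow_succ] using LinearMap.congr_fun hf3 x
    have hg3' : ∀ x, g (g (g x)) = x :=
      fun x => by simpa [pow_succ] using LinearMap.congr_fun hg3 x
    rcases classify hV halt hskew hnd hf hf3' h3 hw with h | h | ⟨e₁, e₂, h⟩
    · exact (not_one hV hirr h).elim
    · rcases classify hV halt hskew hnd hg hg3' h3 hw with h' | h' | ⟨f₁, f₂, h'⟩
      · exact (not_one hV (irr_symm hirr) h').elim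
      · exact (not_quad hV hirr h h').elim
      · have hgf : (g * f) ^ c = (1 : Module.End K V) := by
          have hgi : g * (g * g) = (1 : Module.End K V) := by
            rw [← hg3]; rfl
          have hgi' : (g * g) * g = (1 : Module.End K V) := by
            rw [← hg3]; rfl
          let u : (Module.End K V)ˣ := ⟨g, g * g, hgi, hgi'⟩
          have : g * f = u * (f * g) * (u⁻¹ : (Module.End K V)ˣ) := by
            simp only [u, Units.inv_mk]
            change g * f = g * (f * g) * (g * g)
            rw [mul_assoc, mul_assoc f g, hgi, mul_one]
          rw [this, Units.conj_pow, hfg]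
          simp
        obtain ⟨b, hb⟩ := case2 hV halt hskew (irr_symm hirr) hgf hw h' hf h
        exact ⟨b, Or.inr ⟨_, hb, rfl⟩⟩
    · rcases classify hV halt hskew hnd hg hg3' h3 hw with h' | h' | ⟨f₁, f₂, h'⟩
      · exact (not_one hV (irr_symm hirr) h').elim
      · obtain ⟨b, hb⟩ := case2 hV halt hskew hirr hfg hw h hg h'
        exact ⟨b, Or.inl (Or.inr hb)⟩
      · obtain ⟨b, hb⟩ := case1 hV halt hskew hirr hfg hw h h'
        exact ⟨b, Or.inl (Or.inl hb)⟩

end Abstract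

section Concrete

open Matrix

variable {K : Type*} [Field K]

/-- the standard symplectic form -/
noncomputable def form (K : Type*) [Field K] :
    (Fin 2 ⊕ Fin 2 → K) →ₗ[K] (Fin 2 ⊕ Fin 2 → K) →ₗ[K] K :=
  Matrix.toLinearMap₂' K (J (Fin 2) K)

lemma form_apply (x y : Fin 2 ⊕ Fin 2 → K) :
    form K x y = x ⬝ᵥ (J (Fin 2) K *ᵥ y) := by
  rw [form, Matrix.toLinearMap₂'_apply']

lemma form_apply' (x y : Fin 2 ⊕ Fin 2 → K) :
    form K x y = - (x (Sum.inl 0) * y (Sum.inr 0)) - x (Sum.inl 1) * y (Sum.inr 1)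
      + x (Sum.inr 0) * y (Sum.inl 0) + x (Sum.inr 1) * y (Sum.inl 1) := by
  rw [form_apply]
  simp [dotProduct, mulVec, J, Fintype.sum_sum_type, Matrix.one_apply]
  ring

lemma form_alt (x : Fin 2 ⊕ Fin 2 → K) : form K x x = 0 := by
  rw [form_apply']; ring

lemma form_nd (x : Fin 2 ⊕ Fin 2 → K) (hx : x ≠ 0) : ∃ y, form K x y ≠ 0 := by
  by_contra! h
  apply hx
  ext i
  have h1 := h (Pi.single (Sum.inl 0) 1)
  have h2 := h (Pi.single (Sum.inl 1) 1)
  have h3 := h (Pi.single (Sum.inr 0) 1)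
  have h4 := h (Pi.single (Sum.inr 1) 1)
  rw [form_apply'] at h1 h2 h3 h4
  simp at h1 h2 h3 h4
  rcases i with i | i <;> fin_cases i <;> simp <;> assumption

lemma form_inv {A : Matrix (Fin 2 ⊕ Fin 2) (Fin 2 ⊕ Fin 2) K} (hA : A ∈ symplecticGroup (Fin 2) K)
    (x y : Fin 2 ⊕ Fin 2 → K) :
    form K (Matrix.toLin' A x) (Matrix.toLin' A y) = form K x y := by
  rw [SymplecticGroup.mem_iff'] at hA
  simp only [form_apply, Matrix.toLin'_apply]
  rw [← Matrix.vecMul_transpose, ← Matrix.dotProduct_mulVec, Matrix.mulVec_mulVec,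
    Matrix.mulVec_mulVec, hA]

variable {F : Type*} [Field F]

lemma upper_mem {S : Matrix (Fin 2) (Fin 2) F} (hS : Sᵀ = S) :
    fromBlocks 1 S 0 1 ∈ symplecticGroup (Fin 2) F := by
  rw [SymplecticGroup.fromBlocks_mem_iff]; simp [hS]

lemma lower_mem {S : Matrix (Fin 2) (Fin 2) F} (hS : Sᵀ = S) :
    fromBlocks 1 0 S 1 ∈ symplecticGroup (Fin 2) F := by
  rw [SymplecticGroup.fromBlocks_mem_iff]; simp [hS]

/-- the vector with given coordinates -/
def vec (a b c d : K) : Fin 2 ⊕ Fin 2 → K := Sum.elim ![a, b] ![c, d]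

lemma vec_smul (t a b c d : K) : t • vec a b c d = vec (t * a) (t * b) (t * c) (t * d) := by
  ext i; rcases i with i | i <;> fin_cases i <;> simp [vec]

lemma vec_add (a b c d a' b' c' d' : K) :
    vec a b c d + vec a' b' c' d' = vec (a + a') (b + b') (c + c') (d + d') := by
  ext i; rcases i with i | i <;> fin_cases i <;> simp [vec]

lemma exists_vec (x : Fin 2 ⊕ Fin 2 → K) : ∃ a b c d, x = vec a b c d :=
  ⟨x (Sum.inl 0), x (Sum.inl 1), x (Sum.inr 0), x (Sum.inr 1), by
    ext i; rcases i with i | i <;> fin_cases i <;> simp [vec]⟩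

lemma irreducible (φ : F →+* K) (W : Submodule K (Fin 2 ⊕ Fin 2 → K))
    (hW : ∀ A ∈ symplecticGroup (Fin 2) F, ∀ x ∈ W, Matrix.toLin' (A.map φ) x ∈ W)
    (hne : W ≠ ⊥) : W = ⊤ := by
  have hU : ∀ s t u : F, ∀ a b c d : K, vec a b c d ∈ W →
      vec (φ s * c + φ t * d) (φ t * c + φ u * d) 0 0 ∈ W := by
    intro s t u a b c d h
    have h1 := hW _ (upper_mem (S := !![s, t; t, u]) (by ext i j; fin_cases i <;> fin_cases j <;> rfl))
      _ h
    have h2 := W.sub_mem h1 h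
    convert h2 using 1
    ext i
    rcases i with i | i <;> fin_cases i <;>
      simp [vec, mulVec, dotProduct, Fintype.sum_sum_type, Matrix.one_apply]
  have hL : ∀ s t u : F, ∀ a b c d : K, vec a b c d ∈ W →
      vec 0 0 (φ s * a + φ t * b) (φ t * a + φ u * b) ∈ W := by
    intro s t u a b c d h
    have h1 := hW _ (lower_mem (S := !![s, t; t, u]) (by ext i j; fin_cases i <;> fin_cases j <;> rfl))
      _ h
    have h2 := W.sub_mem h1 h
    convert h2 using 1
    ext i
    rcases i with i | i <;> fin_cases i <;>
      simp [vec, mulVec, dotProduct, Fintype.sum_sum_type, Matrix.one_apply]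
  obtain ⟨x, hx, hx0⟩ := (Submodule.ne_bot_iff _).1 hne
  obtain ⟨a, b, c, d, rfl⟩ := exists_vec x
  have e1 : vec 1 0 0 0 ∈ W ∨ vec 0 1 0 0 ∈ W := by
    by_cases hc : c = 0
    · by_cases hd : d = 0
      · by_cases ha : a = 0
        · have hb : b ≠ 0 := by
            rintro rfl
            apply hx0
            subst ha hc hd
            ext i; rcases i with i | i <;> fin_cases i <;> simp [vec]
          right
          have h1 := hL 0 0 1 _ _ _ _ hx
          have h2 := hU 0 0 1 _ _ _ _ h1
          have h3 := W.smul_mem b⁻¹ h2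
          rw [vec_smul] at h3
          simpa [hb] using h3
        · left
          have h1 := hL 1 0 0 _ _ _ _ hx
          have h2 := hU 1 0 0 _ _ _ _ h1
          have h3 := W.smul_mem a⁻¹ h2
          rw [vec_smul] at h3
          simpa [ha] using h3
      · right
        have h2 := hU 0 0 1 _ _ _ _ hx
        have h3 := W.smul_mem d⁻¹ h2
        rw [vec_smul] at h3
        simpa [hd] using h3
    · left
      have h2 := hU 1 0 0 _ _ _ _ hx
      have h3 := W.smul_mem c⁻¹ h2
      rw [vec_smul] at h3
      simpa [hc] using h3
  have all : vec 1 0 0 0 ∈ W ∧ vec 0 1 0 0 ∈ W ∧ vec 0 0 1 0 ∈ W ∧ vec 0 0 0 1 ∈ W := by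
    have hf1 : vec 0 0 1 0 ∈ W := by
      rcases e1 with h | h
      · simpa using hL 1 0 0 _ _ _ _ h
      · simpa using hL 0 1 0 _ _ _ _ h
    have he1 : vec 1 0 0 0 ∈ W := by simpa using hU 1 0 0 _ _ _ _ hf1
    have he2 : vec 0 1 0 0 ∈ W := by simpa using hU 0 1 0 _ _ _ _ hf1
    exact ⟨he1, he2, hf1, by simpa using hL 0 0 1 _ _ _ _ he2⟩
  obtain ⟨a1, a2, a3, a4⟩ := all
  rw [eq_top_iff]
  intro x _
  obtain ⟨a, b, c, d, rfl⟩ := exists_vec x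
  have := W.add_mem (W.add_mem (W.smul_mem a a1) (W.smul_mem b a2))
    (W.add_mem (W.smul_mem c a3) (W.smul_mem d a4))
  simp only [vec_smul, vec_add] at this
  simpa using this

/-- the natural representation over a larger field, as matrices with respect to a basis -/
noncomputable def rep (φ : F →+* K) (b : Basis (Fin 4) K (Fin 2 ⊕ Fin 2 → K)) :
    symplecticGroup (Fin 2) F →* Matrix (Fin 4) (Fin 4) K where
  toFun A := LinearMap.toMatrix b b (Matrix.toLin' (A.1.map φ))
  map_one' := by
    simp [Matrix.map_one]
  map_mul' A B := by
    rw [← LinearMap.toMatrix_mul]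
    congr 1
    simp [Matrix.map_mul, Matrix.toLin'_mul, Module.End.mul_eq_comp]

lemma rep_injective (φ : F →+* K) (b : Basis (Fin 4) K (Fin 2 ⊕ Fin 2 → K)) :
    Function.Injective (rep φ b) := by
  intro A B h
  have h1 := (LinearMap.toMatrix b b).injective h
  have h2 := Matrix.toLin'.injective h1
  exact Subtype.ext (Matrix.map_injective φ.injective h2)

lemma card_le (F : Type*) [Field F] [Finite F] :
    Nat.card F ≤ Nat.card (symplecticGroup (Fin 2) F) := by
  refine Nat.card_le_card_of_injective
    (fun t : F => (⟨fromBlocks 1 !![t, 0; 0, 0] 0 1, upper_mem (by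
      ext i j; fin_cases i <;> fin_cases j <;> rfl)⟩ : symplecticGroup (Fin 2) F)) ?_
  intro s t h
  have := congrFun (congrFun (congrArg Subtype.val h) (Sum.inl 0)) (Sum.inr 0)
  simpa using this

lemma submonoid_closure {G : Type*} [Group G] {x y : G} (hx : x ^ 3 = 1) (hy : y ^ 3 = 1)
    (h : Subgroup.closure {x, y} = ⊤) : Submonoid.closure {x, y} = ⊤ := by
  rw [eq_top_iff]
  intro g _
  have hg : g ∈ Subgroup.closure {x, y} := by rw [h]; trivial
  rw [← Subgroup.mem_toSubmonoid, Subgroup.closure_toSubmonoid] at hg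
  refine (Submonoid.closure_le.2 ?_) hg
  have hxm : x ∈ Submonoid.closure {x, y} := Submonoid.subset_closure (by simp)
  have hym : y ∈ Submonoid.closure {x, y} := Submonoid.subset_closure (by simp)
  have key : ∀ z : G, z ^ 3 = 1 → z⁻¹ = z ^ 2 := by
    intro z hz
    rw [inv_eq_iff_mul_eq_one, ← pow_succ', hz]
  rintro z (hz | hz)
  · exact Submonoid.subset_closure hz
  · rcases hz with hz | hz
    · have : z = x ^ 2 := by rw [← key x hx, ← hz, inv_inv]
      rw [this]; exact pow_mem hxm 2
    · have hz : z⁻¹ = y := hz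
      have : z = y ^ 2 := by rw [← key y hy, ← hz, inv_inv]
      rw [this]; exact pow_mem hym 2

lemma irr_of_closure (φ : F →+* K) {x y : symplecticGroup (Fin 2) F}
    (h : Submonoid.closure {x, y} = ⊤) :
    Irr (Matrix.toLin' (x.1.map φ)) (Matrix.toLin' (y.1.map φ)) := by
  intro W hx hy hne
  refine irreducible φ W ?_ hne
  intro A hA
  have hmem : (⟨A, hA⟩ : symplecticGroup (Fin 2) F) ∈ Submonoid.closure {x, y} := by
    rw [h]; trivial
  suffices ∀ g ∈ Submonoid.closure {x, y}, ∀ v ∈ W,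
      Matrix.toLin' (g.1.map φ) v ∈ W from this _ hmem
  intro g hg
  induction hg using Submonoid.closure_induction with
  | mem g hg =>
    rcases hg with rfl | hg
    · exact hx
    · have hg : g = y := hg
      subst hg; exact hy
  | one => intro v hv; simpa [Matrix.map_one] using hv
  | mul a b _ _ ha hb =>
    intro v hv
    have := ha _ (hb v hv)
    simpa [Matrix.map_mul] using this

lemma pow_toLin (φ : F →+* K) {x : symplecticGroup (Fin 2) F} {n : ℕ} (h : x ^ n = 1) :
    (Matrix.toLin' (x.1.map φ)) ^ n
      = (1 : Module.End K (Fin 2 ⊕ Fin 2 → K)) := by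
  have h1 : x.1 ^ n = 1 := by
    have := congrArg Subtype.val h
    simpa using this
  rw [← Matrix.toLin'_pow, ← Matrix.map_pow, h1]
  simp [Matrix.map_one, Module.End.one_eq_id]

end Concrete

end SpTri

/-- For a fixed prime `p` and positive integer `c`, there are only finitely
many positive integers `r` such that `Sp₄(p^r)` is `(3,3,c)`-generated, i.e.
generated by elements `g₁, g₂` with `g₁³ = g₂³ = (g₁g₂)^c = 1`. -/
theorem stmt_15 (p : ℕ) [Fact p.Prime] (c : ℕ) (hc : 0 < c) :
    {r : ℕ | 0 < r ∧ ∃ g₁ g₂ : Matrix.symplecticGroup (Fin 2) (GaloisField p r),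
      g₁ ^ 3 = 1 ∧ g₂ ^ 3 = 1 ∧ (g₁ * g₂) ^ c = 1 ∧
      Subgroup.closure {g₁, g₂} = ⊤}.Finite := by
  obtain ⟨S, hS, hmain⟩ := SpTri.finitely_many (K := AlgebraicClosure (ZMod p)) c hc
  have hcard := hS.image (fun q => Nat.card (Submonoid.closure {q.1, q.2}))
  obtain ⟨N, hN⟩ := hcard.bddAbove
  refine (Set.finite_Iic N).subset ?_
  rintro r ⟨hr, g₁, g₂, h1, h2, h12, hgen⟩
  have hp : p.Prime := Fact.out
  let φ : GaloisField p r →+* AlgebraicClosure (ZMod p) :=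
    (IsAlgClosed.lift : GaloisField p r →ₐ[ZMod p] AlgebraicClosure (ZMod p)).toRingHom
  have hcl := SpTri.submonoid_closure h1 h2 hgen
  have hprod : (Matrix.toLin' (g₁.1.map φ) *
      Matrix.toLin' (g₂.1.map φ)) ^ c
        = (1 : Module.End (AlgebraicClosure (ZMod p)) _) := by
    have h := SpTri.pow_toLin φ h12
    rw [Submonoid.coe_mul, Matrix.map_mul, Matrix.toLin'_mul] at h
    exact h
  obtain ⟨b, hb⟩ := hmain (Fin 2 ⊕ Fin 2 → AlgebraicClosure (ZMod p)) (by simp)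
    (SpTri.form _) SpTri.form_alt SpTri.form_nd
    (Matrix.toLin' (g₁.1.map φ))
    (Matrix.toLin' (g₂.1.map φ))
    (SpTri.form_inv (SymplecticGroup.map_mem g₁.2 φ))
    (SpTri.form_inv (SymplecticGroup.map_mem g₂.2 φ))
    (SpTri.pow_toLin φ h1) (SpTri.pow_toLin φ h2) hprod (SpTri.irr_of_closure φ hcl)
  have hle : Nat.card (Submonoid.closure {SpTri.rep φ b g₁, SpTri.rep φ b g₂}) ≤ N :=
    hN ⟨_, hb, rfl⟩
  have hmap : Submonoid.closure {SpTri.rep φ b g₁, SpTri.rep φ b g₂}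
      = (⊤ : Submonoid _).map (SpTri.rep φ b) := by
    rw [← hcl, MonoidHom.map_mclosure, Set.image_pair]
  rw [hmap] at hle
  have hc1 : Nat.card ((⊤ : Submonoid (Matrix.symplecticGroup (Fin 2) (GaloisField p r))).map
      (SpTri.rep φ b)) = Nat.card (Matrix.symplecticGroup (Fin 2) (GaloisField p r)) := by
    rw [← Nat.card_congr (Submonoid.equivMapOfInjective ⊤ _ (SpTri.rep_injective φ b)).toEquiv]
    exact Nat.card_congr Submonoid.topEquiv.toEquiv
  rw [hc1] at hle
  have h3 := SpTri.card_le (GaloisField p r)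
  rw [GaloisField.card p r hr.ne'] at h3
  exact ((Nat.lt_pow_self hp.one_lt).le.trans h3).trans hle
end
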